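/- Fix an integer K ≥ 0 and define s_n = Σ_{0 ≤ r ≤ K} ℙ(E_r^{(n)}) for n ≥ 1, where E_r^{(n)} are the row-growth events of the Plancherel growth process. Then lim_{n→∞} √n · s_n = K + 1. -/

import Mathlib

open MeasureTheory Filter

/-- The number of standard Young tableaux of shape `μ`: bijective fillings of the cells of `μ`
by `0, 1, …, μ.card - 1` that are strictly increasing along rows and columns. -/
noncomputable def sytCount (μ : YoungDiagram) : ℕ :=
  Nat.card {T : μ.cells → Fin μ.card //
    Function.Bijective T ∧
      ∀ a b : μ.cells, (a : ℕ × ℕ).1 ≤ (b : ℕ × ℕ).1 → (a : ℕ × ℕ).2 ≤ (b : ℕ × ℕ).2 →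
        a ≠ b → T a < T b}

/-- `lam 0 ↗ lam 1 ↗ ⋯` is a Plancherel growth process: the probability of any prescribed
initial path `∅ = μ⁽⁰⁾ ↗ μ⁽¹⁾ ↗ ⋯ ↗ μ⁽ⁿ⁾` in the Young graph equals `d_{μ⁽ⁿ⁾} / n!`,
which characterizes the distribution of the sequence of RSK shapes of an i.i.d. uniform
sequence. -/
def IsPlancherelGrowthProcess {Ω : Type*} [MeasurableSpace Ω] (P : Measure Ω)
    (lam : ℕ → Ω → YoungDiagram) : Prop :=
  IsProbabilityMeasure P ∧
  (∀ (n : ℕ) (y : YoungDiagram), MeasurableSet {ω | lam n ω = y}) ∧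
  ∀ (n : ℕ) (path : ℕ → YoungDiagram), path 0 = ⊥ →
    (∀ i, i < n → path i ≤ path (i + 1) ∧ (path (i + 1)).card = (path i).card + 1) →
    P {ω | ∀ i ≤ n, lam i ω = path i} =
      (sytCount (path n) : ENNReal) / (Nat.factorial n : ENNReal)

/-- The event `E_r⁽ⁿ⁺¹⁾` that the box added in step `n+1` of the growth process
(i.e. the unique box of `λ⁽ⁿ⁺¹⁾ ∖ λ⁽ⁿ⁾`) lies in the row with index `r`. -/
def growthEvent {Ω : Type*} (lam : ℕ → Ω → YoungDiagram) (n r : ℕ) : Set Ω :=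
  {ω | (lam (n + 1) ω).rowLen r = (lam n ω).rowLen r + 1}

namespace PG
open Finset

theorem level_finite (n : ℕ) : {μ : YoungDiagram | μ.card = n}.Finite := by
  have hinj : Function.Injective YoungDiagram.cells := fun a b h => YoungDiagram.ext h
  refine Set.Finite.of_injOn (f := YoungDiagram.cells)
    (t := ((range n ×ˢ range n).powerset : Finset (Finset (ℕ × ℕ)))) ?_ hinj.injOn
    (Finset.finite_toSet _)
  intro μ hμ
  have hμ : μ.card = n := hμ
  simp only [coe_powerset, Set.mem_preimage, Set.mem_powerset_iff, coe_subset]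
  rintro ⟨i, j⟩ hx
  rw [YoungDiagram.mem_cells] at hx
  have h1 : (range (i+1)).image (fun a => (a, 0)) ⊆ μ.cells := by
    intro x hx'
    simp only [mem_image, mem_range] at hx'
    obtain ⟨a, ha, rfl⟩ := hx'
    exact μ.up_left_mem (by omega) (Nat.zero_le _) hx
  have h2 : (range (j+1)).image (fun a => (0, a)) ⊆ μ.cells := by
    intro x hx'
    simp only [mem_image, mem_range] at hx'
    obtain ⟨a, ha, rfl⟩ := hx'
    exact μ.up_left_mem (Nat.zero_le _) (by omega) hx
  have h1' := card_le_card h1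
  have h2' := card_le_card h2
  rw [card_image_of_injective _ (fun a b h => by simpa using h), card_range] at h1' h2'
  have : μ.cells.card = n := hμ
  simp only [mem_product, mem_range]
  omega

/-- Young diagrams with `n` boxes. -/
noncomputable def Y (n : ℕ) : Finset YoungDiagram := (level_finite n).toFinset

@[simp] theorem mem_Y {n : ℕ} {μ : YoungDiagram} : μ ∈ Y n ↔ μ.card = n := by simp [Y]

open Classical in
noncomputable def up (n : ℕ) (ν : YoungDiagram) : Finset YoungDiagram := (Y (n+1)).filter (ν ≤ ·)
open Classical in
noncomputable def dn (n : ℕ) (μ : YoungDiagram) : Finset YoungDiagram := (Y n).filter (· ≤ μ)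

@[simp] theorem mem_up {n : ℕ} {ν μ : YoungDiagram} : μ ∈ up n ν ↔ μ.card = n + 1 ∧ ν ≤ μ := by
  simp [up]
@[simp] theorem mem_dn {n : ℕ} {ν μ : YoungDiagram} : ν ∈ dn n μ ↔ ν.card = n ∧ ν ≤ μ := by
  simp [dn]

theorem sum_swap (n : ℕ) (f : YoungDiagram → YoungDiagram → ℝ) :
    ∑ ν ∈ Y n, ∑ μ ∈ up n ν, f ν μ = ∑ μ ∈ Y (n+1), ∑ ν ∈ dn n μ, f ν μ := by
  apply Finset.sum_comm'
  intro x y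
  simp
  tauto

/-- weight -/
noncomputable def H (φ : ℕ × ℕ → ℝ) (μ : YoungDiagram) : ℝ := ∑ x ∈ μ.cells, φ x

theorem H_sup_inf (φ : ℕ × ℕ → ℝ) (μ ν : YoungDiagram) :
    H φ (μ ⊔ ν) + H φ (μ ⊓ ν) = H φ μ + H φ ν := by
  simp only [H, YoungDiagram.cells_sup, YoungDiagram.cells_inf]
  exact Finset.sum_union_inter

theorem card_sup_inf (μ ν : YoungDiagram) :
    (μ ⊔ ν).card + (μ ⊓ ν).card = μ.card + ν.card := by
  simp only [YoungDiagram.card, YoungDiagram.cells_sup, YoungDiagram.cells_inf]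
  exact Finset.card_union_add_card_inter _ _

theorem card_mono {μ ν : YoungDiagram} (h : μ ≤ ν) : μ.card ≤ ν.card :=
  card_le_card (YoungDiagram.cells_subset_iff.2 h)

theorem eq_of_le_card {μ ν : YoungDiagram} (h : μ ≤ ν) (hc : ν.card ≤ μ.card) : μ = ν :=
  YoungDiagram.ext (eq_of_subset_of_card_le (YoungDiagram.cells_subset_iff.2 h) hc)

theorem exists_insert {ν μ : YoungDiagram} (h : ν ≤ μ) (hc : μ.card = ν.card + 1) :
    ∃ x, x ∉ ν.cells ∧ μ.cells = insert x ν.cells := by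
  obtain ⟨x, hx, h⟩ := exists_eq_insert_iff.2 ⟨YoungDiagram.cells_subset_iff.2 h, hc.symm⟩
  exact ⟨x, hx, h.symm⟩

theorem H_edge {ν μ : YoungDiagram} {x : ℕ × ℕ} (hx : x ∉ ν.cells) (h : μ.cells = insert x ν.cells)
    (φ : ℕ × ℕ → ℝ) : H φ μ - H φ ν = φ x := by
  simp only [H, h, sum_insert hx]
  ring

open Classical in
/-- off-diagonal cancellation -/
theorem comm_off (φ : ℕ × ℕ → ℝ) (n : ℕ) {ν ν' : YoungDiagram} (hν : ν.card = n+1)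
    (hν' : ν'.card = n+1) (hne : ν ≠ ν') :
    (∑ μ ∈ up (n+1) ν, if ν' ≤ μ then (H φ μ - H φ ν) else 0) =
    (∑ κ ∈ dn n ν, if κ ≤ ν' then (H φ ν' - H φ κ) else 0) := by
  classical
  have hlt : (ν ⊓ ν').card < n + 1 := by
    by_contra hcon
    have h1 : ν ⊓ ν' = ν := eq_of_le_card inf_le_left (by omega)
    have h2 : ν ⊓ ν' = ν' := eq_of_le_card inf_le_right (by omega)
    exact hne (h1.symm.trans h2)
  have hci := card_sup_inf ν ν'
  rw [← sum_filter, ← sum_filter]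
  by_cases hc : (ν ⊓ ν').card = n
  · have e1 : (up (n+1) ν).filter (fun μ => ν' ≤ μ) = {ν ⊔ ν'} := by
      ext μ
      simp only [mem_filter, mem_up, mem_singleton]
      constructor
      · rintro ⟨⟨h1, h2⟩, h3⟩
        exact (eq_of_le_card (sup_le h2 h3) (by omega)).symm
      · rintro rfl
        exact ⟨⟨by omega, le_sup_left⟩, le_sup_right⟩
    have e2 : (dn n ν).filter (fun κ => κ ≤ ν') = {ν ⊓ ν'} := by
      ext μ
      simp only [mem_filter, mem_dn, mem_singleton]
      constructor
      · rintro ⟨⟨h1, h2⟩, h3⟩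
        exact (eq_of_le_card (le_inf h2 h3) (by omega))
      · rintro rfl
        exact ⟨⟨by omega, inf_le_left⟩, inf_le_right⟩
    rw [e1, e2, sum_singleton, sum_singleton]
    linarith [H_sup_inf φ ν ν']
  · have e1 : (up (n+1) ν).filter (fun μ => ν' ≤ μ) = ∅ := by
      ext μ
      simp only [mem_filter, mem_up, notMem_empty, iff_false]
      rintro ⟨⟨h1, h2⟩, h3⟩
      have := card_mono (sup_le h2 h3)
      omega
    have e2 : (dn n ν).filter (fun κ => κ ≤ ν') = ∅ := by
      ext μ
      simp only [mem_filter, mem_dn, notMem_empty, iff_false]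
      rintro ⟨⟨h1, h2⟩, h3⟩
      have := card_mono (le_inf h2 h3)
      omega
    rw [e1, e2]; simp

noncomputable def upsum (φ : ℕ × ℕ → ℝ) (n : ℕ) (ν : YoungDiagram) : ℝ :=
  ∑ μ ∈ up n ν, (H φ μ - H φ ν)
noncomputable def dnsum (φ : ℕ × ℕ → ℝ) (n : ℕ) (ν : YoungDiagram) : ℝ :=
  ∑ κ ∈ dn n ν, (H φ ν - H φ κ)

theorem comm (φ : ℕ × ℕ → ℝ) (n : ℕ) {ν : YoungDiagram} (hν : ν.card = n+1)
    (w : YoungDiagram → ℝ) :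
    ∑ μ ∈ up (n+1) ν, (H φ μ - H φ ν) * ∑ ν' ∈ dn (n+1) μ, w ν' =
    ∑ κ ∈ dn n ν, ∑ ν' ∈ up n κ, (H φ ν' - H φ κ) * w ν' +
      (upsum φ (n+1) ν - dnsum φ n ν) * w ν := by
  classical
  have e1 : ∑ μ ∈ up (n+1) ν, (H φ μ - H φ ν) * ∑ ν' ∈ dn (n+1) μ, w ν' =
      ∑ ν' ∈ Y (n+1), (∑ μ ∈ up (n+1) ν, if ν' ≤ μ then (H φ μ - H φ ν) else 0) * w ν' := by
    simp_rw [sum_mul]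
    rw [sum_comm]
    refine sum_congr rfl fun μ _ => ?_
    rw [dn, mul_sum, sum_filter]
    refine sum_congr rfl fun ν' _ => ?_
    split_ifs <;> simp
  have e2 : ∑ κ ∈ dn n ν, ∑ ν' ∈ up n κ, (H φ ν' - H φ κ) * w ν' =
      ∑ ν' ∈ Y (n+1), (∑ κ ∈ dn n ν, if κ ≤ ν' then (H φ ν' - H φ κ) else 0) * w ν' := by
    simp_rw [sum_mul]
    rw [sum_comm]
    refine sum_congr rfl fun μ _ => ?_
    rw [up, sum_filter]
    refine sum_congr rfl fun ν' _ => ?_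
    split_ifs <;> simp
  rw [e1, e2]
  have hm : ν ∈ Y (n+1) := by simp [hν]
  rw [← add_sum_erase _ _ hm, ← add_sum_erase _ _ hm]
  have e3 : (∑ μ ∈ up (n+1) ν, if ν ≤ μ then (H φ μ - H φ ν) else 0) = upsum φ (n+1) ν := by
    refine sum_congr rfl fun μ h => ?_
    rw [if_pos (mem_up.1 h).2]
  have e4 : (∑ κ ∈ dn n ν, if κ ≤ ν then (H φ ν - H φ κ) else 0) = dnsum φ n ν := by
    refine sum_congr rfl fun μ h => ?_
    rw [if_pos (mem_dn.1 h).2]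
  rw [e3, e4]
  have e5 : ∑ ν' ∈ (Y (n+1)).erase ν,
      (∑ μ ∈ up (n+1) ν, if ν' ≤ μ then (H φ μ - H φ ν) else 0) * w ν' =
      ∑ ν' ∈ (Y (n+1)).erase ν,
        (∑ κ ∈ dn n ν, if κ ≤ ν' then (H φ ν' - H φ κ) else 0) * w ν' := by
    refine sum_congr rfl fun ν' h => ?_
    rw [mem_erase, mem_Y] at h
    rw [comm_off φ n hν h.2 (Ne.symm h.1)]
  rw [e5]; ring

/-! diagonal -/

def addable (ν : YoungDiagram) (i : ℕ) : Prop := i = 0 ∨ ν.rowLen i < ν.rowLen (i-1)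

theorem addable_lower {ν : YoungDiagram} {i : ℕ} (h : addable ν i) :
    IsLowerSet ((insert (i, ν.rowLen i) ν.cells : Finset (ℕ × ℕ)) : Set (ℕ × ℕ)) := by
  rintro ⟨a, b⟩ ⟨a', b'⟩ hle hm
  simp only [coe_insert, Set.mem_insert_iff, mem_coe, YoungDiagram.mem_cells, Prod.mk.injEq,
    YoungDiagram.mem_iff_lt_rowLen] at hm ⊢
  have h1 : a' ≤ a := hle.1
  have h2 : b' ≤ b := hle.2
  have h3 := ν.rowLen_anti a' a h1
  rcases hm with ⟨rfl, rfl⟩ | hm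
  · rcases Nat.lt_or_ge a' a with hlt | hge
    · right
      rcases h with h | h
      · omega
      · have := ν.rowLen_anti a' (a-1) (by omega)
        omega
    · obtain rfl : a' = a := by omega
      omega
  · right; omega

open Classical in
noncomputable def addBox (ν : YoungDiagram) (i : ℕ) : YoungDiagram :=
  if h : addable ν i then ⟨insert (i, ν.rowLen i) ν.cells, addable_lower h⟩ else ν

theorem addBox_cells {ν : YoungDiagram} {i : ℕ} (h : addable ν i) :
    (addBox ν i).cells = insert (i, ν.rowLen i) ν.cells := by
  simp [addBox, h]

theorem notMem_row (ν : YoungDiagram) (i : ℕ) : (i, ν.rowLen i) ∉ ν.cells := by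
  rw [YoungDiagram.mem_cells, YoungDiagram.mem_iff_lt_rowLen]; omega

theorem card_addBox {ν : YoungDiagram} {i : ℕ} (h : addable ν i) :
    (addBox ν i).card = ν.card + 1 := by
  rw [YoungDiagram.card, addBox_cells h, card_insert_of_notMem (notMem_row ν i)]

theorem le_addBox {ν : YoungDiagram} {i : ℕ} (h : addable ν i) : ν ≤ addBox ν i := by
  rw [← YoungDiagram.cells_subset_iff, addBox_cells h]; exact subset_insert _ _

theorem insert_form {ν μ : YoungDiagram} {i j : ℕ} (hx : (i, j) ∉ ν.cells)
    (h : μ.cells = insert (i, j) ν.cells) : j = ν.rowLen i ∧ addable ν i := by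
  rw [YoungDiagram.mem_cells, YoungDiagram.mem_iff_lt_rowLen] at hx
  have hm : ∀ x, x ∈ μ ↔ x = (i,j) ∨ x ∈ ν := by
    intro x; rw [← YoungDiagram.mem_cells, h]; simp
  have hij : (i, j) ∈ μ := (hm _).2 (Or.inl rfl)
  have hj : j = ν.rowLen i := by
    by_contra hne
    have : (i, ν.rowLen i) ∈ μ := μ.up_left_mem le_rfl (by omega) hij
    rw [hm, YoungDiagram.mem_iff_lt_rowLen] at this
    simp at this; omega
  refine ⟨hj, ?_⟩
  by_contra hna
  unfold addable at hna
  push Not at hna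
  have : (i-1, j) ∈ μ := μ.up_left_mem (by omega) le_rfl hij
  rw [hm, YoungDiagram.mem_iff_lt_rowLen] at this
  simp at this
  omega

theorem row_le_card {ν : YoungDiagram} {i : ℕ} (h : 0 < ν.rowLen i) : i < ν.card := by
  have h1 : (range (i+1)).image (fun a => (a, 0)) ⊆ ν.cells := by
    intro x hx'
    simp only [mem_image, mem_range] at hx'
    obtain ⟨a, ha, rfl⟩ := hx'
    exact ν.up_left_mem (by omega) (Nat.zero_le _) (YoungDiagram.mem_iff_lt_rowLen.2 h)
  have h1' := card_le_card h1
  rw [card_image_of_injective _ (fun a b h => by simpa using h), card_range] at h1'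
  exact h1'

theorem rowLen_zero {ν : YoungDiagram} {i : ℕ} (h : ν.card ≤ i) : ν.rowLen i = 0 := by
  by_contra hne
  have := row_le_card (Nat.pos_of_ne_zero hne)
  omega

open Classical in
theorem upsum_eq (φ : ℕ × ℕ → ℝ) {n : ℕ} {ν : YoungDiagram} (hν : ν.card = n) :
    upsum φ n ν = ∑ i ∈ range (n+1), if addable ν i then φ (i, ν.rowLen i) else 0 := by
  rw [← sum_filter, upsum]
  symm
  refine sum_bij (fun i _ => addBox ν i) ?_ ?_ ?_ ?_
  · intro i hi
    rw [mem_filter] at hi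
    rw [mem_up, card_addBox hi.2, hν]
    exact ⟨rfl, le_addBox hi.2⟩
  · intro i hi i' hi' he
    rw [mem_filter] at hi hi'
    have : (i, ν.rowLen i) ∈ (addBox ν i').cells := by
      rw [← he, addBox_cells hi.2]; simp
    rw [addBox_cells hi'.2, mem_insert] at this
    rcases this with h | h
    · exact (Prod.mk.inj h).1
    · exact absurd h (notMem_row ν i)
  · intro μ hμ
    rw [mem_up] at hμ
    obtain ⟨⟨i, j⟩, hx, hc⟩ := exists_insert hμ.2 (by omega)
    obtain ⟨rfl, ha⟩ := insert_form hx hc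
    refine ⟨i, ?_, ?_⟩
    · rw [mem_filter, mem_range]
      refine ⟨?_, ha⟩
      rcases ha with ha | ha
      · omega
      · have := @row_le_card ν (i-1) (by omega)
        omega
    · apply YoungDiagram.ext
      rw [addBox_cells ha, hc]
  · intro i hi
    rw [mem_filter] at hi
    rw [H_edge (notMem_row ν i) (addBox_cells hi.2)]

theorem rem_lower {ν : YoungDiagram} {i : ℕ} (h : ν.rowLen (i+1) < ν.rowLen i) :
    IsLowerSet ((ν.cells.erase (i, ν.rowLen i - 1) : Finset (ℕ × ℕ)) : Set (ℕ × ℕ)) := by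
  rintro ⟨a, b⟩ ⟨a', b'⟩ hle hm
  simp only [mem_coe, mem_erase, YoungDiagram.mem_cells, Prod.mk.injEq, ne_eq,
    YoungDiagram.mem_iff_lt_rowLen] at hm ⊢
  have h1 : a' ≤ a := hle.1
  have h2 : b' ≤ b := hle.2
  have h3 := ν.rowLen_anti a' a h1
  refine ⟨?_, by omega⟩
  rintro ⟨rfl, rfl⟩
  rcases Nat.lt_or_ge a' a with hlt | hge
  · have := ν.rowLen_anti (a'+1) a (by omega)
    omega
  · obtain rfl : a = a' := by omega
    have := hm.1
    simp at this
    omega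

open Classical in
noncomputable def remBox (ν : YoungDiagram) (i : ℕ) : YoungDiagram :=
  if h : ν.rowLen (i+1) < ν.rowLen i then ⟨ν.cells.erase (i, ν.rowLen i - 1), rem_lower h⟩ else ν

theorem remBox_cells {ν : YoungDiagram} {i : ℕ} (h : ν.rowLen (i+1) < ν.rowLen i) :
    (remBox ν i).cells = ν.cells.erase (i, ν.rowLen i - 1) := by
  simp [remBox, h]

theorem mem_row_last {ν : YoungDiagram} {i : ℕ} (h : ν.rowLen (i+1) < ν.rowLen i) :
    (i, ν.rowLen i - 1) ∈ ν.cells := by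
  rw [YoungDiagram.mem_cells, YoungDiagram.mem_iff_lt_rowLen]; omega

open Classical in
theorem dnsum_eq (φ : ℕ × ℕ → ℝ) {n : ℕ} {ν : YoungDiagram} (hν : ν.card = n+1) :
    dnsum φ n ν = ∑ i ∈ range (n+1),
      if ν.rowLen (i+1) < ν.rowLen i then φ (i, ν.rowLen i - 1) else 0 := by
  rw [← sum_filter, dnsum]
  symm
  have hins : ∀ i, ν.rowLen (i+1) < ν.rowLen i →
      ν.cells = insert (i, ν.rowLen i - 1) (remBox ν i).cells := by
    intro i h
    rw [remBox_cells h, insert_erase (mem_row_last h)]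
  refine sum_bij (fun i _ => remBox ν i) ?_ ?_ ?_ ?_
  · intro i hi
    rw [mem_filter] at hi
    rw [mem_dn]
    constructor
    · rw [YoungDiagram.card, remBox_cells hi.2, card_erase_of_mem (mem_row_last hi.2)]
      have : ν.cells.card = n+1 := hν
      omega
    · rw [← YoungDiagram.cells_subset_iff, remBox_cells hi.2]
      exact erase_subset _ _
  · intro i hi i' hi' he
    rw [mem_filter] at hi hi'
    have : (i, ν.rowLen i - 1) ∉ (remBox ν i').cells := by
      rw [← he, remBox_cells hi.2]; simp
    rw [remBox_cells hi'.2, mem_erase] at this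
    push Not at this
    by_contra hne
    exact this (fun h => hne (Prod.mk.inj h).1) (mem_row_last hi.2)
  · intro κ hκ
    rw [mem_dn] at hκ
    obtain ⟨⟨i, j⟩, hx, hc⟩ := exists_insert hκ.2 (by omega)
    obtain ⟨hj, ha⟩ := insert_form hx hc
    have hmem : ∀ a b, b < ν.rowLen a ↔ (a = i ∧ b = j) ∨ b < κ.rowLen a := by
      intro a b
      rw [← YoungDiagram.mem_iff_lt_rowLen, ← YoungDiagram.mem_iff_lt_rowLen,
        ← YoungDiagram.mem_cells, hc]; simp
    have r1 : ν.rowLen i = j + 1 := by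
      have a1 := hmem i j
      have a2 := hmem i (j+1)
      simp at a1 a2
      omega
    have r2 : ν.rowLen (i+1) ≤ j := by
      have a1 := hmem (i+1) j
      have := κ.rowLen_anti i (i+1) (by omega)
      simp at a1
      omega
    have hr : ν.rowLen (i+1) < ν.rowLen i := by omega
    refine ⟨i, ?_, ?_⟩
    · rw [mem_filter, mem_range]
      refine ⟨?_, hr⟩
      have := @row_le_card ν i (by omega)
      omega
    · apply YoungDiagram.ext
      rw [remBox_cells hr, hc, r1]
      simp only [Nat.add_sub_cancel]
      rw [erase_insert hx]
  · intro i hi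
    rw [mem_filter] at hi
    rw [H_edge (ν := remBox ν i) (μ := ν) (x := (i, ν.rowLen i - 1)) ?_ (hins i hi.2)]
    rw [remBox_cells hi.2]; simp

/-- content -/
def ct (x : ℕ × ℕ) : ℝ := (x.2 : ℝ) - x.1

theorem H_rows (φ : ℕ × ℕ → ℝ) {n : ℕ} {ν : YoungDiagram} (hν : ν.card = n) :
    H φ ν = ∑ i ∈ range n, ∑ j ∈ range (ν.rowLen i), φ (i, j) := by
  rw [H, Finset.sum_sigma']
  refine sum_bij' (fun x _ => ⟨x.1, x.2⟩) (fun s _ => (s.1, s.2)) ?_ ?_ ?_ ?_ ?_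
  · rintro ⟨i, j⟩ hx
    rw [YoungDiagram.mem_cells, YoungDiagram.mem_iff_lt_rowLen] at hx
    simp only [mem_sigma, mem_range]
    exact ⟨hν ▸ row_le_card (by omega), hx⟩
  · rintro ⟨i, j⟩ hx
    simp only [mem_sigma, mem_range] at hx
    rw [YoungDiagram.mem_cells, YoungDiagram.mem_iff_lt_rowLen]; exact hx.2
  · simp
  · simp
  · simp

theorem G_content (ψ : ℝ → ℝ) {n : ℕ} {ν : YoungDiagram} (hν : ν.card = n+1) :
    upsum (fun x => ψ (ct x)) (n+1) ν - dnsum (fun x => ψ (ct x)) n ν =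
      ψ 0 + H (fun x => ψ (ct x + 1) + ψ (ct x - 1) - 2 * ψ (ct x)) ν := by
  classical
  rw [upsum_eq _ hν, dnsum_eq _ hν, H_rows _ hν, sum_range_succ', add_sub_right_comm,
    ← sum_sub_distrib]
  have e0 : (if addable ν 0 then ψ (ct (0, ν.rowLen 0)) else 0) = ψ (ν.rowLen 0) := by
    rw [if_pos (show addable ν 0 from Or.inl rfl)]; simp [ct]
  have e1 : ∀ i ∈ range (n+1),
      ((if addable ν (i+1) then ψ (ct (i+1, ν.rowLen (i+1))) else 0) -
      if ν.rowLen (i+1) < ν.rowLen i then ψ (ct (i, ν.rowLen i - 1)) else 0) =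
      ψ (ν.rowLen (i+1) - (i+1)) - ψ (ν.rowLen i - 1 - i) := by
    intro i _
    by_cases h : ν.rowLen (i+1) < ν.rowLen i
    · rw [if_pos h, if_pos (show addable ν (i+1) from Or.inr (by simpa using h))]
      simp only [ct]
      rw [Nat.cast_sub (by omega)]
      push_cast; ring_nf
    · have h' : ¬ addable ν (i+1) := by
        unfold addable; simpa using h
      rw [if_neg h, if_neg h']
      have := ν.rowLen_anti i (i+1) (by omega)
      have e : ν.rowLen (i+1) = ν.rowLen i := by omega
      rw [e]; ring_nf
  have e2 : ∀ i, ∑ j ∈ range (ν.rowLen i),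
      (ψ (ct (i, j) + 1) + ψ (ct (i, j) - 1) - 2 * ψ (ct (i, j))) =
      ψ (ν.rowLen i - i) - ψ (-i) - ψ (ν.rowLen i - 1 - i) + ψ (- 1 - i) := by
    intro i
    generalize ν.rowLen i = m
    induction m with
    | zero => simp
    | succ m ih =>
      rw [sum_range_succ, ih]
      simp only [ct]; push_cast; ring_nf
  rw [sum_congr rfl e1, e0, sum_congr rfl (fun i _ => e2 i)]
  have hz : ν.rowLen (n+1) = 0 := rowLen_zero (by omega)
  have key : ∀ m : ℕ, ∑ i ∈ range m, (ψ (ν.rowLen (i+1) - (i+1)) - ψ (ν.rowLen i - 1 - i)) +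
      ψ (ν.rowLen 0) = ψ 0 + ∑ i ∈ range m,
        (ψ (ν.rowLen i - i) - ψ (-i) - ψ (ν.rowLen i - 1 - i) + ψ (- 1 - i))
        + ψ (ν.rowLen m - m) - ψ (-m) := by
    intro m
    induction m with
    | zero => simp
    | succ m ih =>
      rw [sum_range_succ, sum_range_succ]
      have : (-1 - (m:ℝ)) = -((m+1 : ℕ) : ℝ) := by push_cast; ring
      rw [this]
      push_cast at ih ⊢
      linarith
  have := key (n+1)
  rw [hz] at this
  push_cast at this
  rw [this]
  have e : (0 - ((n:ℝ)+1)) = -((n:ℝ)+1) := by ring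
  rw [e]; ring

theorem G_one {n : ℕ} {ν : YoungDiagram} (hν : ν.card = n+1) :
    upsum (fun _ => 1) (n+1) ν - dnsum (fun _ => 1) n ν = 1 := by
  rw [G_content (fun _ => 1) hν]
  simp only [H]; norm_num

theorem G_row (K : ℕ) {n : ℕ} {ν : YoungDiagram} (hν : ν.card = n+1) :
    0 ≤ upsum (fun x => if x.1 ≤ K then 1 else 0) (n+1) ν -
      dnsum (fun x => if x.1 ≤ K then 1 else 0) n ν := by
  classical
  rw [upsum_eq _ hν, dnsum_eq _ hν, sub_nonneg]
  have hadd : ∀ i, ν.rowLen (i+1) < ν.rowLen i ↔ addable ν (i+1) := by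
    intro i; simp [addable]
  simp only [hadd]
  have key : ∀ m : ℕ, (∑ i ∈ range m, if addable ν (i+1) then (if i ≤ K then (1:ℝ) else 0) else 0)
     ≤ (∑ i ∈ range (m), if addable ν i then (if i ≤ K then (1:ℝ) else 0) else 0)
       + (if addable ν m then (if m ≤ K then (1:ℝ) else 0) else 0)
       := by
    intro m
    rw [← sum_range_succ, sum_range_succ']
    rw [if_pos (show addable ν 0 from Or.inl rfl), if_pos (Nat.zero_le _)]
    rcases le_or_gt m K with h | h
    · have : ∀ i ∈ range m, (if addable ν (i+1) then (if i ≤ K then (1:ℝ) else 0) else 0) ≤ 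
        (if addable ν (i+1) then (if i+1 ≤ K then (1:ℝ) else 0) else 0) := by
        intro i hi
        rw [mem_range] at hi
        rw [if_pos (show i ≤ K by omega), if_pos (show i+1 ≤ K by omega)]
      linarith [sum_le_sum this]
    · have hK : K ∈ range m := by simpa using h
      rw [← add_sum_erase _ _ hK, ← add_sum_erase _ _ hK]
      have : ∀ i ∈ (range m).erase K, (if addable ν (i+1) then (if i ≤ K then (1:ℝ) else 0) else 0) = 
        (if addable ν (i+1) then (if i+1 ≤ K then (1:ℝ) else 0) else 0) := by
        intro i hi
        rw [mem_erase] at hi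
        have : i ≤ K ↔ i + 1 ≤ K := by omega
        simp [this]
      rw [sum_congr rfl this]
      have a1 : (if addable ν (K+1) then (if K ≤ K then (1:ℝ) else 0) else 0) ≤ 1 := by
        split_ifs <;> norm_num
      have a2 : 0 ≤ (if addable ν (K+1) then (if K+1 ≤ K then (1:ℝ) else 0) else 0) := by
        split_ifs <;> norm_num
      linarith
  have := key (n+1)
  rw [sum_range_succ (fun i => if addable ν i then (if i ≤ K then (1:ℝ) else 0) else 0) (n+1)]
  exact this

end PG

namespace PG
open Finset

/-- Standard tableaux as functions on the plane. -/
def SY (μ : YoungDiagram) : Set (ℕ × ℕ → ℕ) :=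
  {f | (∀ x, x ∉ μ → f x = 0) ∧ (∀ x ∈ μ, f x < μ.card) ∧
    (∀ a ∈ μ, ∀ b ∈ μ, f a = f b → a = b) ∧
    ∀ a ∈ μ, ∀ b ∈ μ, a.1 ≤ b.1 → a.2 ≤ b.2 → a ≠ b → f a < f b}

open Classical in
noncomputable def toSY (μ : YoungDiagram) (T : μ.cells → Fin μ.card) : ℕ × ℕ → ℕ :=
  fun x => if h : x ∈ μ.cells then (T ⟨x, h⟩ : ℕ) else 0

theorem toSY_apply {μ : YoungDiagram} (T : μ.cells → Fin μ.card) {x : ℕ × ℕ} (h : x ∈ μ.cells) :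
    toSY μ T x = T ⟨x, h⟩ := by simp only [toSY, dif_pos h]

theorem card_SY (μ : YoungDiagram) : Finite (SY μ) ∧ Nat.card (SY μ) = sytCount μ := by
  have hb : ∃ F : {T : μ.cells → Fin μ.card //
    Function.Bijective T ∧
      ∀ a b : μ.cells, (a : ℕ × ℕ).1 ≤ (b : ℕ × ℕ).1 → (a : ℕ × ℕ).2 ≤ (b : ℕ × ℕ).2 →
        a ≠ b → T a < T b} → SY μ, Function.Bijective F := by
    refine ⟨fun T => ⟨toSY μ T.1, ?_, ?_, ?_, ?_⟩, ?_, ?_⟩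
    · intro x hx
      rw [← YoungDiagram.mem_cells] at hx
      simp only [toSY, dif_neg hx]
    · intro x hx
      rw [toSY_apply _ ((YoungDiagram.mem_cells x).2 hx)]
      exact Fin.is_lt _
    · intro a ha b hb h
      rw [toSY_apply _ ((YoungDiagram.mem_cells a).2 ha),
        toSY_apply _ ((YoungDiagram.mem_cells b).2 hb)] at h
      have := T.2.1.1 (Fin.ext h)
      simpa using this
    · intro a ha b hb h1 h2 h3
      rw [toSY_apply _ ((YoungDiagram.mem_cells a).2 ha),
        toSY_apply _ ((YoungDiagram.mem_cells b).2 hb)]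
      exact T.2.2 _ _ h1 h2 (by simpa using h3)
    · rintro ⟨T, hT⟩ ⟨T', hT'⟩ h
      have h' : toSY μ T = toSY μ T' := congrArg Subtype.val h
      apply Subtype.ext
      funext ⟨x, hx⟩
      have := congrFun h' x
      rw [toSY_apply _ hx, toSY_apply _ hx] at this
      exact Fin.ext this
    · rintro ⟨f, h1, h2, h3, h4⟩
      have hinj : Function.Injective (fun x : μ.cells => (⟨f x, h2 x x.2⟩ : Fin μ.card)) := by
        intro a b h
        simp only [Fin.mk.injEq] at h
        exact Subtype.ext (h3 a a.2 b b.2 h)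
      refine ⟨⟨fun x => ⟨f x, h2 x x.2⟩, ?_, ?_⟩, ?_⟩
      · rw [Fintype.bijective_iff_injective_and_card]
        refine ⟨hinj, ?_⟩
        simp
      · intro a b ha hb hne
        exact h4 a a.2 b b.2 ha hb (fun h => hne (Subtype.ext h))
      · apply Subtype.ext
        funext x
        by_cases hx : x ∈ μ.cells
        · simp only [toSY, dif_pos hx]
        · simp only [toSY, dif_neg hx]
          exact (h1 x hx).symm
  obtain ⟨F, hF⟩ := hb
  refine ⟨Finite.of_surjective F hF.2, ?_⟩
  exact (Nat.card_eq_of_bijective F hF).symm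

open Classical in
noncomputable def ext (n : ℕ) (μ ν : YoungDiagram) (f : ℕ × ℕ → ℕ) : ℕ × ℕ → ℕ :=
  fun x => if x ∈ ν then f x else if x ∈ μ then n else 0

theorem syt_rec_nat {n : ℕ} {μ : YoungDiagram} (hμ : μ.card = n + 1) :
    sytCount μ = ∑ ν ∈ dn n μ, sytCount ν := by
  classical
  have hfin : ∀ ν : dn n μ, Finite (SY ν.1) := fun ν => (card_SY ν.1).1
  have hb : ∃ F : (Σ ν : dn n μ, SY ν.1) → SY μ, Function.Bijective F := by
    have hmem : ∀ ν : dn n μ, ∀ f ∈ SY ν.1, ext n μ ν.1 f ∈ SY μ := by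
      rintro ⟨ν, hν⟩ f ⟨h1, h2, h3, h4⟩
      simp only at h1 h2 h3 h4 ⊢
      rw [mem_dn] at hν
      obtain ⟨y, hy, hc⟩ := exists_insert hν.2 (by omega)
      have hm : ∀ x, x ∈ μ ↔ x = y ∨ x ∈ ν := by
        intro x; rw [← YoungDiagram.mem_cells, hc]; simp
      rw [YoungDiagram.mem_cells] at hy
      have fy : ext n μ ν f y = n := by simp [ext, hy, (hm y).2 (Or.inl rfl)]
      have fν : ∀ x ∈ ν, ext n μ ν f x = f x := fun x hx => by simp [ext, hx]
      have fl : ∀ x ∈ ν, f x < n := fun x hx => hν.1 ▸ h2 x hx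
      refine ⟨?_, ?_, ?_, ?_⟩
      · intro x hx
        have : x ∉ ν := fun h => hx ((hm x).2 (Or.inr h))
        simp [ext, hx, this]
      · intro x hx
        rcases (hm x).1 hx with rfl | h
        · rw [fy]; omega
        · rw [fν x h]; have := fl x h; omega
      · intro a ha b hb hab
        rcases (hm a).1 ha with rfl | h <;> rcases (hm b).1 hb with rfl | h'
        · rfl
        · rw [fy, fν b h'] at hab; have := fl b h'; omega
        · rw [fy, fν a h] at hab; have := fl a h; omega
        · rw [fν a h, fν b h'] at hab; exact h3 a h b h' hab
      · intro a ha b hb hab1 hab2 hne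
        rcases (hm a).1 ha with rfl | h <;> rcases (hm b).1 hb with rfl | h'
        · exact absurd rfl hne
        · exfalso
          exact hy (ν.up_left_mem hab1 hab2 h')
        · rw [fy, fν a h]; exact fl a h
        · rw [fν a h, fν b h']; exact h4 a h b h' hab1 hab2 hne
    refine ⟨fun p => ⟨ext n μ p.1.1 p.2.1, hmem p.1 p.2.1 p.2.2⟩, ?_, ?_⟩
    · rintro ⟨⟨ν, hν⟩, ⟨f, hf⟩⟩ ⟨⟨ν', hν'⟩, ⟨f', hf'⟩⟩ h
      simp only [Subtype.mk.injEq] at h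
      rw [mem_dn] at hν hν'
      have key : ∀ (ν : YoungDiagram) f, f ∈ SY ν → ν.card = n → ν ≤ μ → ∀ x ∈ μ,
          (x ∈ ν ↔ ext n μ ν f x < n) := by
        intro ν f hf hc hl x hx
        constructor
        · intro h
          simp only [ext, if_pos h]
          exact hc ▸ hf.2.1 x h
        · intro h
          by_contra hcon
          simp [ext, hcon, hx] at h
      have hνν : ν = ν' := by
        apply YoungDiagram.ext
        ext x
        rw [YoungDiagram.mem_cells, YoungDiagram.mem_cells]
        by_cases hx : x ∈ μ
        · rw [key ν f hf hν.1 hν.2 x hx, key ν' f' hf' hν'.1 hν'.2 x hx, h]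
        · exact ⟨fun h => absurd (hν.2 h) hx, fun h => absurd (hν'.2 h) hx⟩
      subst hνν
      have : f = f' := by
        funext x
        by_cases hx : x ∈ ν
        · have := congrFun h x
          simpa [ext, hx] using this
        · rw [hf.1 x hx, hf'.1 x hx]
      subst this
      rfl
    · rintro ⟨f, h1, h2, h3, h4⟩
      -- the maximal entry
      have himg : μ.cells.image f = range (n+1) := by
        apply eq_of_subset_of_card_le
        · intro y hy
          rw [mem_image] at hy
          obtain ⟨x, hx, rfl⟩ := hy
          rw [mem_range]; exact hμ ▸ h2 x hx
        · rw [card_image_of_injOn (fun a ha b hb h => h3 a ha b hb h), card_range]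
          exact hμ.ge
      obtain ⟨y, hy, hyn⟩ : ∃ y ∈ μ.cells, f y = n := by
        have : n ∈ μ.cells.image f := by rw [himg]; simp
        simpa using this
      have hlow : IsLowerSet ((μ.cells.erase y : Finset (ℕ × ℕ)) : Set (ℕ × ℕ)) := by
        rintro a b hle ha
        simp only [coe_erase, Set.mem_sdiff, mem_coe, Set.mem_singleton_iff] at ha ⊢
        have hbμ : b ∈ μ.cells := μ.up_left_mem hle.1 hle.2 ha.1
        refine ⟨hbμ, ?_⟩
        rintro rfl
        have h5 := h4 b hy a ha.1 hle.1 hle.2 (Ne.symm ha.2)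
        have h6 := h2 a ha.1
        omega
      have hmν : ∀ x, x ∈ (⟨μ.cells.erase y, hlow⟩ : YoungDiagram) ↔ x ≠ y ∧ x ∈ μ := by
        intro x; simp
      have hcν : (⟨μ.cells.erase y, hlow⟩ : YoungDiagram).card = n := by
        simp only [YoungDiagram.card]
        rw [card_erase_of_mem hy]
        have : μ.cells.card = n+1 := hμ
        omega
      generalize hνd : (⟨μ.cells.erase y, hlow⟩ : YoungDiagram) = ν at hmν hcν
      have hle : ν ≤ μ := fun x hx => ((hmν x).1 hx).2
      refine ⟨⟨⟨ν, by rw [mem_dn]; exact ⟨hcν, hle⟩⟩,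
        ⟨fun x => if x ∈ ν then f x else 0, ?_, ?_, ?_, ?_⟩⟩, ?_⟩
      · intro x hx
        simp only at hx
        simp [hx]
      · intro x hx
        simp only at hx
        change (if x ∈ ν then f x else 0) < ν.card
        rw [if_pos hx, hcν]
        have a1 := h2 x (hle hx)
        have a2 : f x ≠ n := fun h => ((hmν x).1 hx).1 (h3 x (hle hx) y hy (h.trans hyn.symm))
        omega
      · intro a ha b hb
        simp only at ha hb
        beta_reduce
        rw [if_pos ha, if_pos hb]
        exact h3 a (hle ha) b (hle hb)
      · intro a ha b hb
        simp only at ha hb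
        beta_reduce
        rw [if_pos ha, if_pos hb]
        exact h4 a (hle ha) b (hle hb)
      · apply Subtype.ext
        funext x
        simp only [ext]
        by_cases hx : x ∈ ν
        · simp [hx]
        · by_cases hx' : x ∈ μ
          · have : x = y := by
              by_contra hne
              exact hx ((hmν x).2 ⟨hne, hx'⟩)
            rw [if_neg hx, if_pos hx', this, hyn]
          · simp [hx, hx', h1 x hx']
  obtain ⟨F, hF⟩ := hb
  rw [← (card_SY μ).2, ← Nat.card_eq_of_bijective F hF, Nat.card_sigma]
  rw [← Finset.sum_coe_sort (dn n μ)]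
  exact sum_congr rfl fun ν _ => (card_SY ν.1).2

theorem eq_bot_of_card {μ : YoungDiagram} (h : μ.card = 0) : μ = ⊥ := by
  apply YoungDiagram.ext
  rw [YoungDiagram.cells_bot]
  exact card_eq_zero.1 h

theorem card_bot : (⊥ : YoungDiagram).card = 0 := by
  simp [YoungDiagram.card]

theorem syt_bot : sytCount ⊥ = 1 := by
  rw [← (card_SY ⊥).2]
  have : SY ⊥ = {fun _ => 0} := by
    ext f
    constructor
    · intro h
      funext x
      exact h.1 x (YoungDiagram.notMem_bot x)
    · rintro rfl
      refine ⟨fun _ _ => rfl, ?_, ?_, ?_⟩ <;> intro x hx <;>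
        exact absurd hx (YoungDiagram.notMem_bot x)
  rw [this]; simp

theorem Y_zero : Y 0 = {⊥} := by
  ext μ
  rw [mem_Y, mem_singleton]
  exact ⟨eq_bot_of_card, fun h => h ▸ card_bot⟩

noncomputable def d (μ : YoungDiagram) : ℝ := sytCount μ

theorem d_nonneg (μ : YoungDiagram) : 0 ≤ d μ := Nat.cast_nonneg _

theorem d_bot : d ⊥ = 1 := by simp [d, syt_bot]

theorem d_rec {n : ℕ} {μ : YoungDiagram} (hμ : μ.card = n + 1) : d μ = ∑ ν ∈ dn n μ, d ν := by
  simp only [d]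
  rw [syt_rec_nat hμ]; push_cast; rfl

theorem edge_one {ν μ : YoungDiagram} {n : ℕ} (h : μ ∈ up n ν) (hν : ν.card = n) :
    H (fun _ => 1) μ - H (fun _ => 1) ν = 1 := by
  rw [mem_up] at h
  obtain ⟨x, hx, hc⟩ := exists_insert h.2 (by omega)
  exact H_edge hx hc _

theorem comm_one (n : ℕ) {ν : YoungDiagram} (hν : ν.card = n+1) (w : YoungDiagram → ℝ) :
    ∑ μ ∈ up (n+1) ν, ∑ ν' ∈ dn (n+1) μ, w ν' =
    ∑ κ ∈ dn n ν, ∑ ν' ∈ up n κ, w ν' + w ν := by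
  have := comm (fun _ => 1) n hν w
  rw [G_one hν, one_mul] at this
  have e1 : ∑ μ ∈ up (n+1) ν, (H (fun _ => 1) μ - H (fun _ => 1) ν) * ∑ ν' ∈ dn (n+1) μ, w ν' =
      ∑ μ ∈ up (n+1) ν, ∑ ν' ∈ dn (n+1) μ, w ν' :=
    sum_congr rfl fun μ h => by rw [edge_one h hν, one_mul]
  have e2 : ∑ κ ∈ dn n ν, ∑ ν' ∈ up n κ, (H (fun _ => 1) ν' - H (fun _ => 1) κ) * w ν' =
      ∑ κ ∈ dn n ν, ∑ ν' ∈ up n κ, w ν' :=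
    sum_congr rfl fun κ h => sum_congr rfl fun μ h' => by
      rw [edge_one h' (mem_dn.1 h).1, one_mul]
  rw [e1, e2] at this
  exact this

theorem addable_bot_iff (i : ℕ) : addable ⊥ i ↔ i = 0 := by
  have h : ∀ j, (⊥ : YoungDiagram).rowLen j = 0 := fun j => rowLen_zero (by rw [card_bot]; omega)
  simp [addable, h]

theorem upsum_bot (φ : ℕ × ℕ → ℝ) : upsum φ 0 ⊥ = φ (0, 0) := by
  rw [upsum_eq φ card_bot]
  have h : (⊥ : YoungDiagram).rowLen 0 = 0 := rowLen_zero (by rw [card_bot])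
  simp [addable_bot_iff, h]

theorem dn_zero {μ : YoungDiagram} : dn 0 μ = {⊥} := by
  ext ν
  rw [mem_dn, mem_singleton]
  exact ⟨fun h => eq_bot_of_card h.1, fun h => h ▸ ⟨card_bot, bot_le⟩⟩

theorem d_level_one {μ : YoungDiagram} (h : μ.card = 1) : d μ = 1 := by
  rw [d_rec h, dn_zero, sum_singleton, d_bot]

theorem sum_up_d (n : ℕ) : ∀ {ν : YoungDiagram}, ν.card = n → ∑ μ ∈ up n ν, d μ = (n+1) * d ν := by
  induction n with
  | zero =>
    intro ν hν
    obtain rfl := eq_bot_of_card hν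
    rw [d_bot]
    have := upsum_bot (fun _ => 1)
    rw [upsum] at this
    rw [Nat.cast_zero, zero_add, one_mul, ← this]
    refine sum_congr rfl fun μ h => ?_
    rw [edge_one h hν, d_level_one (by simpa using (mem_up.1 h).1)]
  | succ n ih =>
    intro ν hν
    have e1 : ∑ μ ∈ up (n+1) ν, d μ = ∑ μ ∈ up (n+1) ν, ∑ ν' ∈ dn (n+1) μ, d ν' :=
      sum_congr rfl fun μ h => d_rec (mem_up.1 h).1
    rw [e1, comm_one n hν]
    have e2 : ∑ κ ∈ dn n ν, ∑ ν' ∈ up n κ, d ν' = ∑ κ ∈ dn n ν, ((n:ℝ)+1) * d κ :=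
      sum_congr rfl fun κ h => ih (mem_dn.1 h).1
    rw [e2, ← mul_sum, ← d_rec hν]
    push_cast; ring

theorem sum_d_sq (n : ℕ) : ∑ ν ∈ Y n, d ν ^ 2 = (n.factorial : ℝ) := by
  induction n with
  | zero => rw [Y_zero]; simp [d_bot]
  | succ n ih =>
    have : ∑ μ ∈ Y (n+1), d μ ^ 2 = ∑ μ ∈ Y (n+1), ∑ ν ∈ dn n μ, d ν * d μ := by
      refine sum_congr rfl fun μ h => ?_
      rw [← sum_mul, ← d_rec (mem_Y.1 h)]; ring
    rw [this, ← sum_swap]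
    have : ∑ ν ∈ Y n, ∑ μ ∈ up n ν, d ν * d μ = ∑ ν ∈ Y n, ((n:ℝ)+1) * d ν ^ 2 := by
      refine sum_congr rfl fun ν h => ?_
      rw [← mul_sum, sum_up_d n (mem_Y.1 h)]; ring
    rw [this, ← mul_sum, ih, Nat.factorial_succ]; push_cast; ring
end PG

namespace PG
open Finset

noncomputable def E (n : ℕ) (h : YoungDiagram → ℝ) : ℝ := (∑ ν ∈ Y n, d ν ^ 2 * h ν) / n.factorial
noncomputable def T (φ : ℕ × ℕ → ℝ) (n : ℕ) : ℝ :=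
  ∑ ν ∈ Y n, ∑ μ ∈ up n ν, (H φ μ - H φ ν) * (d ν * d μ)
noncomputable def A (φ : ℕ × ℕ → ℝ) (n : ℕ) : ℝ := T φ n / (n+1).factorial

theorem fpos (n : ℕ) : (0:ℝ) < n.factorial := by exact_mod_cast n.factorial_pos

theorem fsucc (n : ℕ) : ((n+1).factorial : ℝ) = (n+1) * n.factorial := by
  rw [Nat.factorial_succ]; push_cast; ring

theorem T_succ (φ : ℕ × ℕ → ℝ) (n : ℕ) : T φ (n+1) = (n+1) * T φ n +
    ∑ ν ∈ Y (n+1), d ν ^ 2 * (upsum φ (n+1) ν - dnsum φ n ν) := by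
  have e1 : T φ (n+1) = ∑ ν ∈ Y (n+1), (∑ κ ∈ dn n ν, d ν *
      (∑ ν' ∈ up n κ, (H φ ν' - H φ κ) * d ν') + d ν ^ 2 * (upsum φ (n+1) ν - dnsum φ n ν)) := by
    refine sum_congr rfl fun ν h => ?_
    have := comm φ n (mem_Y.1 h) d
    rw [← mul_sum]
    have h2 : ∑ μ ∈ up (n+1) ν, (H φ μ - H φ ν) * (d ν * d μ) =
        d ν * ∑ μ ∈ up (n+1) ν, (H φ μ - H φ ν) * ∑ ν' ∈ dn (n+1) μ, d ν' := by
      rw [mul_sum]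
      refine sum_congr rfl fun μ h' => ?_
      rw [← d_rec (mem_up.1 h').1]; ring
    rw [h2, this]; ring
  rw [e1, sum_add_distrib]
  congr 1
  rw [← sum_swap n (fun κ ν => d ν * (∑ ν' ∈ up n κ, (H φ ν' - H φ κ) * d ν')), T, mul_sum]
  refine sum_congr rfl fun κ h => ?_
  rw [← sum_mul, sum_up_d n (mem_Y.1 h), mul_assoc, mul_sum]
  congr 1
  refine sum_congr rfl fun μ _ => ?_
  ring

theorem A_succ (φ : ℕ × ℕ → ℝ) (n : ℕ) : ((n:ℝ)+2) * A φ (n+1) = (n+1) * A φ n +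
    E (n+1) (fun ν => upsum φ (n+1) ν - dnsum φ n ν) := by
  have h1 := fpos (n+1)
  have h2 := fsucc (n+1)
  rw [A, A, E, T_succ, h2]
  push_cast
  have h3 : (n:ℝ)+1+1 ≠ 0 := by positivity
  field_simp
  ring

theorem A_zero (φ : ℕ × ℕ → ℝ) : A φ 0 = φ (0,0) := by
  rw [A, T, Y_zero, sum_singleton, ← upsum_bot φ, upsum]
  simp only [zero_add, Nat.factorial_one, Nat.cast_one, div_one]
  refine sum_congr rfl fun μ h => ?_
  rw [d_bot, d_level_one (mem_up.1 h).1]; ring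

theorem E_succ (φ : ℕ × ℕ → ℝ) (n : ℕ) : E (n+1) (H φ) = E n (H φ) + A φ n := by
  have e1 : ∑ μ ∈ Y (n+1), d μ ^ 2 * H φ μ = ∑ μ ∈ Y (n+1), ∑ ν ∈ dn n μ, d ν * d μ * H φ μ := by
    refine sum_congr rfl fun μ h => ?_
    rw [← sum_mul, ← sum_mul, ← d_rec (mem_Y.1 h)]; ring
  have e2 : ∑ μ ∈ Y (n+1), d μ ^ 2 * H φ μ = (n+1) * ∑ ν ∈ Y n, d ν ^ 2 * H φ ν + T φ n := by
    rw [e1, ← sum_swap, T, mul_sum, ← sum_add_distrib]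
    refine sum_congr rfl fun ν h => ?_
    have := sum_up_d n (mem_Y.1 h)
    have e3 : ∑ μ ∈ up n ν, d ν * d μ * H φ μ =
       (∑ μ ∈ up n ν, d μ) * (d ν * H φ ν) + ∑ μ ∈ up n ν, (H φ μ - H φ ν) * (d ν * d μ) := by
      rw [sum_mul, ← sum_add_distrib]
      refine sum_congr rfl fun μ _ => ?_
      ring
    rw [e3, this]; ring
  rw [E, E, A, e2, fsucc]
  have := fpos n
  field_simp

theorem E_zero (φ : ℕ × ℕ → ℝ) : E 0 (H φ) = 0 := by
  rw [E, Y_zero]; simp [H]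

theorem E_eq_sum (φ : ℕ × ℕ → ℝ) (n : ℕ) : E n (H φ) = ∑ m ∈ range n, A φ m := by
  induction n with
  | zero => simp [E_zero]
  | succ n ih => rw [E_succ, ih, sum_range_succ]

theorem E_const (n : ℕ) (c : ℝ) : E n (fun _ => c) = c := by
  have := fpos n
  rw [E, ← sum_mul, sum_d_sq]; field_simp

theorem E_mono {n : ℕ} {h h' : YoungDiagram → ℝ} (H : ∀ ν, ν.card = n → h ν ≤ h' ν) :
    E n h ≤ E n h' := by
  have := fpos n
  unfold E
  gcongr with ν hν
  exact H ν (mem_Y.1 hν)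

theorem E_add (n : ℕ) (h h' : YoungDiagram → ℝ) : E n (fun ν => h ν + h' ν) = E n h + E n h' := by
  simp only [E]
  rw [← add_div, ← sum_add_distrib]
  congr 1
  exact sum_congr rfl fun _ _ => by ring

theorem E_mul (n : ℕ) (c : ℝ) (h : YoungDiagram → ℝ) : E n (fun ν => c * h ν) = c * E n h := by
  simp only [E]
  rw [← mul_div_assoc, mul_sum]
  congr 1
  exact sum_congr rfl fun _ _ => by ring

theorem H_sum {ι : Type*} (s : Finset ι) (c : ι → ℝ) (φ : ι → ℕ × ℕ → ℝ) (μ : YoungDiagram) :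
    H (fun x => ∑ i ∈ s, c i * φ i x) μ = ∑ i ∈ s, c i * H (φ i) μ := by
  simp only [H]
  rw [sum_comm]
  exact sum_congr rfl fun _ _ => by rw [mul_sum]

theorem E_sum {ι : Type*} (s : Finset ι) (c : ι → ℝ) (h : ι → YoungDiagram → ℝ) (n : ℕ) :
    E n (fun x => ∑ i ∈ s, c i * h i x) = ∑ i ∈ s, c i * E n (h i) := by
  simp only [E]
  simp_rw [← mul_div_assoc]
  rw [← sum_div]
  congr 1
  simp_rw [mul_sum]
  rw [sum_comm]
  exact sum_congr rfl fun _ _ => sum_congr rfl fun _ _ => by ring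

theorem A_eq (φ : ℕ × ℕ → ℝ) (n : ℕ) : A φ n = E (n+1) (H φ) - E n (H φ) := by
  rw [E_succ]; ring

theorem A_sum {ι : Type*} (s : Finset ι) (c : ι → ℝ) (φ : ι → ℕ × ℕ → ℝ) (n : ℕ) :
    A (fun x => ∑ i ∈ s, c i * φ i x) n = ∑ i ∈ s, c i * A (φ i) n := by
  have : H (fun x => ∑ i ∈ s, c i * φ i x) = fun μ => ∑ i ∈ s, c i * H (φ i) μ :=
    funext fun μ => H_sum s c φ μ
  simp_rw [A_eq]
  rw [this, E_sum, E_sum, ← sum_sub_distrib]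
  exact sum_congr rfl fun _ _ => by ring

/-! Spectral gap -/

theorem gap (n : ℕ) : ∀ w : YoungDiagram → ℝ, ∑ μ ∈ Y (n+1), d μ * w μ = 0 →
    ∑ ν ∈ Y n, (∑ μ ∈ up n ν, w μ) ^ 2 ≤ n * ∑ μ ∈ Y (n+1), w μ ^ 2 := by
  induction n with
  | zero =>
    intro w hw
    rw [Y_zero, sum_singleton]
    have : up 0 ⊥ = Y 1 := by ext μ; simp
    rw [this]
    have h2 : ∑ μ ∈ Y 1, w μ = 0 := by
      rw [← hw]
      refine sum_congr rfl fun μ h => ?_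
      rw [d_level_one (mem_Y.1 h), one_mul]
    rw [h2]; simp
  | succ n ih =>
    intro w hw
    set D : YoungDiagram → ℝ := fun ν => ∑ μ ∈ up (n+1) ν, w μ with hD
    have h0 : ∑ ν ∈ Y (n+1), d ν * D ν = 0 := by
      simp only [hD, mul_sum]
      rw [sum_swap (n+1) (fun ν μ => d ν * w μ), ← hw]
      refine sum_congr rfl fun μ h => ?_
      rw [← sum_mul, ← d_rec (mem_Y.1 h)]
    have h1 := ih D h0
    have h2 : ∑ ν ∈ Y (n+1), D ν ^ 2 = ∑ μ ∈ Y (n+2), w μ * ∑ ν ∈ dn (n+1) μ, D ν := by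
      simp only [mul_sum]
      rw [← sum_swap (n+1) (fun ν μ => w μ * D ν)]
      refine sum_congr rfl fun ν _ => ?_
      rw [← sum_mul, sq]
    have h3 : ∑ μ ∈ Y (n+2), (∑ ν ∈ dn (n+1) μ, D ν) ^ 2 =
        ∑ κ ∈ Y n, (∑ ν ∈ up n κ, D ν) ^ 2 + ∑ ν ∈ Y (n+1), D ν ^ 2 := by
      have a1 : ∑ μ ∈ Y (n+2), (∑ ν ∈ dn (n+1) μ, D ν) ^ 2 =
          ∑ μ ∈ Y (n+2), ∑ ν ∈ dn (n+1) μ, D ν * ∑ ν' ∈ dn (n+1) μ, D ν' := by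
        refine sum_congr rfl fun μ _ => ?_
        rw [← sum_mul, sq]
      have a2 : ∑ κ ∈ Y n, (∑ ν ∈ up n κ, D ν) ^ 2 =
          ∑ κ ∈ Y n, ∑ ν ∈ up n κ, D ν * ∑ ν' ∈ up n κ, D ν' := by
        refine sum_congr rfl fun μ _ => ?_
        rw [← sum_mul, sq]
      rw [a1, a2, ← sum_swap (n+1) (fun ν μ => D ν * ∑ ν' ∈ dn (n+1) μ, D ν'),
        sum_swap n (fun κ ν => D ν * ∑ ν' ∈ up n κ, D ν'), ← sum_add_distrib]
      refine sum_congr rfl fun ν h => ?_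
      rw [← mul_sum, ← mul_sum, comm_one n (mem_Y.1 h)]; ring
    have h4 := sum_mul_sq_le_sq_mul_sq (Y (n+2)) w (fun μ => ∑ ν ∈ dn (n+1) μ, D ν)
    rw [← h2, h3] at h4
    change ∑ ν ∈ Y (n+1), D ν ^ 2 ≤ _
    have hA : 0 ≤ ∑ ν ∈ Y (n+1), D ν ^ 2 := sum_nonneg fun _ _ => sq_nonneg _
    have hB : 0 ≤ ∑ μ ∈ Y (n+1+1), w μ ^ 2 := sum_nonneg fun _ _ => sq_nonneg _
    generalize ∑ ν ∈ Y (n+1), D ν ^ 2 = a at *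
    change _ ^ 2 ≤ (∑ μ ∈ Y (n+1+1), w μ ^ 2) * _ at h4
    generalize ∑ μ ∈ Y (n+1+1), w μ ^ 2 = b at *
    generalize ∑ κ ∈ Y n, (∑ ν ∈ up n κ, D ν) ^ 2 = c at *
    have h5 : a ^ 2 ≤ b * ((n+1) * a) := by
      refine h4.trans ?_
      apply mul_le_mul_of_nonneg_left _ hB
      linarith
    push_cast
    by_contra hcon
    push Not at hcon
    have : 0 < a := lt_of_le_of_lt (by positivity) hcon
    nlinarith

theorem edge_sq {n : ℕ} {ν μ : YoungDiagram} (hν : ν.card = n) (h : μ ∈ up n ν)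
    (φ : ℕ × ℕ → ℝ) : (H φ μ - H φ ν) ^ 2 = H (fun x => φ x ^ 2) μ - H (fun x => φ x ^ 2) ν := by
  rw [mem_up] at h
  obtain ⟨x, hx, hc⟩ := exists_insert h.2 (by omega)
  rw [H_edge hx hc, H_edge hx hc]

theorem variance (φ : ℕ × ℕ → ℝ) (n : ℕ) :
    E (n+1) (fun μ => (H φ μ - E (n+1) (H φ)) ^ 2) ≤ (n+1) * A (fun x => φ x ^ 2) n := by
  have hf := fpos (n+1)
  set m := E (n+1) (H φ) with hm
  set w : YoungDiagram → ℝ := fun μ => d μ * (H φ μ - m) with hw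
  have h0 : ∑ μ ∈ Y (n+1), d μ * w μ = 0 := by
    have a1 : ∑ μ ∈ Y (n+1), d μ * w μ = ∑ μ ∈ Y (n+1), d μ ^ 2 * H φ μ -
        (∑ μ ∈ Y (n+1), d μ ^ 2) * m := by
      rw [sum_mul, ← sum_sub_distrib]
      exact sum_congr rfl fun _ _ => by simp only [hw]; ring
    rw [a1, sum_d_sq, hm, E]
    field_simp
    ring
  have h1 := gap n w h0
  have h2 : (n+1) * ∑ μ ∈ Y (n+1), w μ ^ 2 - ∑ ν ∈ Y n, (∑ μ ∈ up n ν, w μ) ^ 2 ≤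
      (n+1) * T (fun x => φ x ^ 2) n := by
    have a1 : ∑ μ ∈ Y (n+1), w μ ^ 2 =
        ∑ ν ∈ Y n, ∑ μ ∈ up n ν, d ν * (d μ * (H φ μ - m) ^ 2) := by
      rw [sum_swap]
      refine sum_congr rfl fun μ h => ?_
      rw [← sum_mul, ← d_rec (mem_Y.1 h)]; simp only [hw]; ring
    rw [a1, mul_sum, ← sum_sub_distrib, T, mul_sum]
    refine sum_le_sum fun ν h => ?_
    have hS := sum_up_d n (mem_Y.1 h)
    have b1 : ∑ μ ∈ up n ν, w μ = (H φ ν - m) * ∑ μ ∈ up n ν, d μ +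
        ∑ μ ∈ up n ν, d μ * (H φ μ - H φ ν) := by
      rw [mul_sum, ← sum_add_distrib]
      exact sum_congr rfl fun _ _ => by simp only [hw]; ring
    have b2 : ∑ μ ∈ up n ν, d ν * (d μ * (H φ μ - m) ^ 2) =
        d ν * ((H φ ν - m) ^ 2 * ∑ μ ∈ up n ν, d μ +
        2 * (H φ ν - m) * ∑ μ ∈ up n ν, d μ * (H φ μ - H φ ν)) +
        ∑ μ ∈ up n ν, (H φ μ - H φ ν) ^ 2 * (d ν * d μ) := by
      rw [mul_sum, mul_sum, ← sum_add_distrib, mul_sum, ← sum_add_distrib]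
      exact sum_congr rfl fun _ _ => by ring
    have b3 : ∑ μ ∈ up n ν, (H φ μ - H φ ν) ^ 2 * (d ν * d μ) =
        ∑ μ ∈ up n ν, (H (fun x => φ x ^ 2) μ - H (fun x => φ x ^ 2) ν) * (d ν * d μ) :=
      sum_congr rfl fun μ h' => by rw [edge_sq (mem_Y.1 h) h']
    rw [b1, b2, b3, hS]
    nlinarith [sq_nonneg (∑ μ ∈ up n ν, d μ * (H φ μ - H φ ν))]
  have h3 : E (n+1) (fun μ => (H φ μ - m) ^ 2) = (∑ μ ∈ Y (n+1), w μ ^ 2) / (n+1).factorial := by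
    rw [E]
    congr 1
    exact sum_congr rfl fun _ _ => by simp only [hw]; ring
  rw [h3, A, ← mul_div_assoc]
  apply div_le_div_of_nonneg_right _ hf.le
  linarith

end PG

namespace PG
open Finset

noncomputable def a (k n : ℕ) : ℝ := A (fun x => ct x ^ k) n
noncomputable def M (k n : ℕ) : ℝ := E n (H (fun x => ct x ^ k))
def cf (k i : ℕ) : ℝ := (k.choose i : ℝ) * (1 + (-1) ^ (k - i))

theorem M_eq (k n : ℕ) : M k n = ∑ m ∈ range n, a k m := E_eq_sum _ _

theorem cf_nonneg (k i : ℕ) : 0 ≤ cf k i := by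
  unfold cf
  rcases neg_one_pow_eq_or ℝ (k-i) with h | h <;> rw [h] <;> norm_num

theorem cf_expand (k : ℕ) (x : ℝ) :
    (x+1)^k + (x-1)^k - 2 * x^k = ∑ i ∈ range k, cf k i * x ^ i := by
  rw [sub_eq_add_neg x 1, add_pow, add_pow, ← sum_add_distrib, sum_range_succ]
  simp only [one_pow, mul_one, Nat.sub_self, pow_zero, Nat.choose_self, Nat.cast_one]
  have : ∑ i ∈ range k, (x ^ i * (k.choose i : ℝ) + x ^ i * (-1) ^ (k-i) * (k.choose i : ℝ)) =
      ∑ i ∈ range k, cf k i * x ^ i := sum_congr rfl fun i _ => by unfold cf; ring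
  rw [this]; ring

theorem a_zero (k : ℕ) : a k 0 = 0 ^ k := by
  rw [a, A_zero]; simp [ct]

theorem a_succ (k n : ℕ) : ((n:ℝ)+2) * a k (n+1) = (n+1) * a k n +
    (0 ^ k + ∑ i ∈ range k, cf k i * M i (n+1)) := by
  rw [a, A_succ]
  congr 1
  have : E (n+1) (fun ν => upsum (fun x => ct x ^ k) (n+1) ν - dnsum (fun x => ct x ^ k) n ν) =
      E (n+1) (fun ν => 0 ^ k + ∑ i ∈ range k, cf k i * H (fun x => ct x ^ i) ν) := by
    apply le_antisymm <;> apply E_mono <;> intro ν hν <;>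
      rw [G_content (fun x => x ^ k) hν] <;> simp_rw [cf_expand] <;>
      rw [H_sum (range k) (cf k) (fun i x => ct x ^ i)]
  rw [this, E_add, E_const, E_sum]
  rfl

theorem a_odd : ∀ k, Odd k → ∀ n, a k n = 0 := by
  intro k
  induction k using Nat.strong_induction_on with
  | _ k ih =>
    intro hk n
    induction n with
    | zero => rw [a_zero]; exact zero_pow (by rintro rfl; simp at hk)
    | succ n ihn =>
      have h := a_succ k n
      rw [ihn, zero_pow (by rintro rfl; simp at hk)] at h
      have h2 : ∑ i ∈ range k, cf k i * M i (n+1) = 0 := by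
        refine sum_eq_zero fun i hi => ?_
        rw [mem_range] at hi
        rcases Nat.even_or_odd i with he | ho
        · have : Odd (k - i) := Nat.Odd.sub_even (by omega) hk he
          rw [cf, this.neg_one_pow]; ring
        · rw [M_eq, sum_eq_zero fun m _ => ih i hi ho m, mul_zero]
      rw [h2] at h
      have h3 : ((n:ℝ)+2) * a k (n+1) = 0 := by linarith
      rcases mul_eq_zero.1 h3 with h4 | h4
      · exfalso; have : (0:ℝ) < n + 2 := by positivity
        linarith
      · exact h4

theorem M_even_nonneg {k : ℕ} (hk : Even k) (n : ℕ) : 0 ≤ M k n := by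
  rw [← E_const n 0]
  apply E_mono
  intro ν _
  exact sum_nonneg fun x _ => hk.pow_nonneg _

theorem M_nonneg (k n : ℕ) : 0 ≤ M k n := by
  rcases Nat.even_or_odd k with h | h
  · exact M_even_nonneg h n
  · rw [M_eq, sum_eq_zero fun m _ => a_odd k h m]

theorem a_upper : ∀ k, ∃ C : ℝ, 0 ≤ C ∧ ∀ n : ℕ, a k n ≤ C * ((n:ℝ)+1) ^ (k/2) := by
  intro k
  induction k using Nat.strong_induction_on with
  | _ k ih =>
    choose! C hC0 hC using ih
    have hS : 0 ≤ ∑ i ∈ range k, cf k i * C i :=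
      sum_nonneg fun i hi => mul_nonneg (cf_nonneg _ _) (hC0 i (mem_range.1 hi))
    refine ⟨1 + ∑ i ∈ range k, cf k i * C i, by positivity, ?_⟩
    set D := 1 + ∑ i ∈ range k, cf k i * C i with hD
    have hD1 : 1 ≤ D := by linarith
    have hM : ∀ i ∈ range k, ∀ n, cf k i * M i (n+1) ≤ cf k i * C i * ((n:ℝ)+1)^(k/2) := by
      intro i hi n
      rw [mem_range] at hi
      rcases Nat.even_or_odd (k-i) with he | ho
      · rw [mul_assoc]
        refine mul_le_mul_of_nonneg_left ?_ (cf_nonneg _ _)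
        rw [M_eq]
        have h2 : 2 ≤ k - i := by
          obtain ⟨r, hr⟩ := he; omega
        calc ∑ m ∈ range (n+1), a i m ≤ ∑ m ∈ range (n+1), C i * ((n:ℝ)+1)^(i/2) := by
              refine sum_le_sum fun m hm => (hC i hi m).trans ?_
              have : (m:ℝ) ≤ n := by
                rw [mem_range] at hm; exact_mod_cast (by omega : m ≤ n)
              have := hC0 i hi
              gcongr
          _ = C i * ((n:ℝ)+1)^(i/2+1) := by
              rw [sum_const, card_range, nsmul_eq_mul, pow_succ]; push_cast; ring
          _ ≤ C i * ((n:ℝ)+1)^(k/2) := by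
              have := hC0 i hi
              gcongr
              · linarith [Nat.cast_nonneg (α := ℝ) n]
              · omega
      · rw [cf, ho.neg_one_pow]; simp
    suffices h : ∀ n : ℕ, ((n:ℝ)+1) * a k n ≤ ((n:ℝ)+1) * (D * ((n:ℝ)+1)^(k/2)) by
      intro n
      exact le_of_mul_le_mul_left (h n) (by positivity)
    intro n
    induction n with
    | zero =>
      rw [a_zero]
      simp only [Nat.cast_zero, zero_add, one_pow, mul_one, one_mul]
      have : (0:ℝ)^k ≤ 1 := pow_le_one₀ le_rfl zero_le_one
      linarith
    | succ n ihn =>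
      have h := a_succ k n
      have h1 : (0:ℝ)^k ≤ 1 := pow_le_one₀ le_rfl zero_le_one
      have h2 : ∑ i ∈ range k, cf k i * M i (n+1) ≤
          (∑ i ∈ range k, cf k i * C i) * ((n:ℝ)+1)^(k/2) := by
        rw [sum_mul]; exact sum_le_sum fun i hi => hM i hi n
      have h3 : (1:ℝ) ≤ ((n:ℝ)+1)^(k/2) := one_le_pow₀ (by linarith [Nat.cast_nonneg (α := ℝ) n])
      have h4 : ((n:ℝ)+1)^(k/2) ≤ ((n:ℝ)+2)^(k/2) := by gcongr; norm_num
      have e : ((n+1:ℕ):ℝ)+1 = n + 2 := by push_cast; ring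
      rw [e, h]
      calc _ ≤ ((n:ℝ)+1) * (D * ((n:ℝ)+1)^(k/2)) + D * ((n:ℝ)+1)^(k/2) := by
            have : D * ((n:ℝ)+1)^(k/2) = ((n:ℝ)+1)^(k/2) +
              (∑ i ∈ range k, cf k i * C i) * ((n:ℝ)+1)^(k/2) := by rw [hD]; ring
            linarith
        _ = ((n:ℝ)+2) * (D * ((n:ℝ)+1)^(k/2)) := by ring
        _ ≤ _ := by gcongr

noncomputable def cat (k : ℕ) : ℝ := (k.centralBinom : ℝ) / (k+1)

theorem cat_succ (k : ℕ) : ((k:ℝ)+2) * cat (k+1) = 2 * (2*k+1) * cat k := by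
  have h : ((k:ℝ)+1) * (k+1).centralBinom = 2 * (2*k+1) * k.centralBinom := by
    exact_mod_cast Nat.succ_mul_centralBinom_succ k
  unfold cat
  push_cast
  field_simp
  have h3 : (k:ℝ)+1+1 = k+2 := by ring
  rw [h3]
  field_simp
  linarith

theorem cat_nonneg (k : ℕ) : 0 ≤ cat k := by unfold cat; positivity

theorem a_lower (k : ℕ) : ∀ n : ℕ, cat k * k.factorial * (n.choose k) ≤ a (2*k) n := by
  induction k with
  | zero =>
    intro n
    have : ∀ n : ℕ, ((n:ℝ)+1) * a 0 n = n + 1 := by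
      intro n
      induction n with
      | zero => simp [a_zero]
      | succ n ih =>
        have h := a_succ 0 n
        have e : ((n+1:ℕ):ℝ)+1 = n + 2 := by push_cast; ring
        rw [e, h, ih]; simp; ring
    have h := this n
    have h2 : a 0 n = 1 := by
      have : (n:ℝ)+1 ≠ 0 := by positivity
      field_simp at h
      linarith
    simp [h2, cat]
  | succ k ih =>
    have hM : ∀ n, cat k * k.factorial * (n.choose (k+1)) ≤ M (2*k) n := by
      intro n
      rw [M_eq]
      have : ((n.choose (k+1) : ℕ) : ℝ) = ∑ m ∈ range n, (m.choose k : ℝ) := by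
        rw [← Nat.cast_sum]
        congr 1
        induction n with
        | zero => simp
        | succ n ih => rw [sum_range_succ, ← ih, Nat.choose_succ_succ]; ring
      rw [this, mul_sum]
      exact sum_le_sum fun m _ => ih m
    suffices h : ∀ n : ℕ, cat (k+1) * (k+2).factorial * ((n+1).choose (k+2)) ≤
        ((n:ℝ)+1) * a (2*(k+1)) n by
      intro n
      have h1 := h n
      have h2 : ((n:ℝ)+1) * (n.choose (k+1)) = ((n+1).choose (k+2)) * (k+2) := by
        exact_mod_cast Nat.add_one_mul_choose_eq n (k+1)
      have h3 := fsucc (k+1)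
      refine le_of_mul_le_mul_left (le_trans (le_of_eq ?_) h1) (by positivity : (0:ℝ) < n+1)
      rw [show k + 2 = k+1+1 from rfl, h3]
      push_cast
      calc _ = cat (k+1) * (k+1).factorial * (((n:ℝ)+1) * (n.choose (k+1))) := by ring
        _ = _ := by rw [h2]; ring
    intro n
    induction n with
    | zero =>
      rw [a_zero, Nat.choose_eq_zero_of_lt (by omega)]; simp
    | succ n ihn =>
      have h := a_succ (2*(k+1)) n
      have e : ((n+1:ℕ):ℝ)+1 = n + 2 := by push_cast; ring
      rw [e, h, Nat.choose_succ_succ]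
      have h1 : cf (2*(k+1)) (2*k) * M (2*k) (n+1) ≤
          ∑ i ∈ range (2*(k+1)), cf (2*(k+1)) i * M i (n+1) :=
        single_le_sum (f := fun i => cf (2*(k+1)) i * M i (n+1))
          (fun i _ => mul_nonneg (cf_nonneg _ _) (M_nonneg _ _)) (by simp)
      have h2 : cf (2*(k+1)) (2*k) = (2*k+2)*(2*k+1) := by
        have : (2*(k+1)).choose (2*k) = (k+1)*(2*k+1) := by
          rw [← Nat.choose_symm (by omega), show 2*(k+1) - 2*k = 2 by omega, Nat.choose_two_right]
          rw [show 2*(k+1)*(2*(k+1)-1) = 2*((k+1)*(2*k+1)) by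
            rw [show 2*(k+1)-1 = 2*k+1 by omega]; ring]
          simp
        rw [cf, this, show 2*(k+1) - 2*k = 2 by omega]
        push_cast; ring
      have h3 := hM (n+1)
      have h4 := cat_succ k
      have h5 := fsucc (k+1)
      have h6 := fsucc k
      have h7 : cat (k+1) * (k+2).factorial = (2*k+2)*(2*k+1) * (cat k * k.factorial) := by
        rw [show k + 2 = k+1+1 from rfl, h5, h6]
        push_cast
        calc _ = (((k:ℝ)+2) * cat (k+1)) * ((k+1) * k.factorial) := by ring
          _ = _ := by rw [h4]; ring
      have h8 : cat (k+1) * (k+2).factorial * ((n+1).choose (k+1)) ≤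
          cf (2*(k+1)) (2*k) * M (2*k) (n+1) := by
        rw [h7, h2]
        have := mul_le_mul_of_nonneg_left h3 (by positivity : (0:ℝ) ≤ (2*k+2)*(2*k+1))
        linarith
      have h9 : (0:ℝ) ≤ 0 ^ (2*(k+1)) := by positivity
      push_cast at *
      linarith

theorem M_lower (k n : ℕ) : cat k * k.factorial * (n.choose (k+1)) ≤ M (2*k) n := by
  rw [M_eq]
  have : ((n.choose (k+1) : ℕ) : ℝ) = ∑ m ∈ range n, (m.choose k : ℝ) := by
    rw [← Nat.cast_sum]
    congr 1
    induction n with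
    | zero => simp
    | succ n ih => rw [sum_range_succ, ← ih, Nat.choose_succ_succ]; ring
  rw [this, mul_sum]
  exact sum_le_sum fun m _ => a_lower k m

end PG

namespace PG
open Finset

def rho (r : ℕ) (x : ℕ × ℕ) : ℝ := if x.1 = r then 1 else 0
noncomputable def q (r n : ℕ) : ℝ := A (rho r) n

theorem rho_nonneg (r : ℕ) (x : ℕ × ℕ) : 0 ≤ rho r x := by
  unfold rho; split_ifs <;> norm_num

theorem H_rho (r : ℕ) (μ : YoungDiagram) : H (rho r) μ = μ.rowLen r := by
  rw [H, YoungDiagram.rowLen_eq_card, YoungDiagram.row]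
  simp [rho]

theorem edge_nonneg {φ : ℕ × ℕ → ℝ} (hφ : ∀ x, 0 ≤ φ x) {n : ℕ} {ν μ : YoungDiagram}
    (hν : ν.card = n) (h : μ ∈ up n ν) : 0 ≤ H φ μ - H φ ν := by
  rw [mem_up] at h
  obtain ⟨x, hx, hc⟩ := exists_insert h.2 (by omega)
  rw [H_edge hx hc]; exact hφ x

theorem A_nonneg {φ : ℕ × ℕ → ℝ} (hφ : ∀ x, 0 ≤ φ x) (n : ℕ) : 0 ≤ A φ n := by
  refine div_nonneg (sum_nonneg fun ν hν => sum_nonneg fun μ hμ => ?_) (fpos _).le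
  exact mul_nonneg (edge_nonneg hφ (mem_Y.1 hν) hμ) (mul_nonneg (d_nonneg _) (d_nonneg _))

theorem sum_rho_le (r : ℕ) (s : Finset ℕ) (P : ℕ → Prop) [DecidablePred P] (f : ℕ → ℕ) :
    ∑ i ∈ s, (if P i then rho r (i, f i) else 0) ≤ 1 := by
  calc _ ≤ ∑ i ∈ s, (if i = r then (1:ℝ) else 0) := by
        refine sum_le_sum fun i _ => ?_
        simp only [rho]
        split_ifs <;> norm_num
    _ ≤ 1 := by
        rw [sum_ite_eq']; split_ifs <;> norm_num

theorem q_nonneg (r n : ℕ) : 0 ≤ q r n := A_nonneg (rho_nonneg r) n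

theorem q_le (r n : ℕ) : q r n ≤ 1 / √((n:ℝ)+1) := by
  classical
  set t := √((n:ℝ)+1) with ht
  have ht0 : 0 < t := Real.sqrt_pos.2 (by positivity)
  have ht2 : t * t = n + 1 := Real.mul_self_sqrt (by positivity)
  have h1 : T (rho r) n ≤ ∑ ν ∈ Y n, ∑ μ ∈ up n ν, ((H (rho r) μ - H (rho r) ν) * (t/2 * d ν^2) +
      (H (rho r) μ - H (rho r) ν) * (1/(2*t) * d μ^2)) := by
    refine sum_le_sum fun ν hν => sum_le_sum fun μ hμ => ?_
    rw [← mul_add]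
    refine mul_le_mul_of_nonneg_left ?_ (edge_nonneg (rho_nonneg r) (mem_Y.1 hν) hμ)
    have : t/2 * d ν^2 + 1/(2*t) * d μ^2 - d ν * d μ = (t * d ν - d μ)^2/(2*t) := by
      field_simp; ring
    have h2 : 0 ≤ (t * d ν - d μ)^2/(2*t) := by positivity
    linarith
  simp_rw [sum_add_distrib] at h1
  rw [sum_swap n (fun ν μ => (H (rho r) μ - H (rho r) ν) * (1/(2*t) * d μ^2))] at h1
  have h2 : ∑ ν ∈ Y n, ∑ μ ∈ up n ν, (H (rho r) μ - H (rho r) ν) * (t/2 * d ν^2) ≤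
      t/2 * n.factorial := by
    rw [← sum_d_sq, mul_sum]
    refine sum_le_sum fun ν hν => ?_
    rw [← sum_mul]
    refine mul_le_of_le_one_left (by positivity) ?_
    change upsum (rho r) n ν ≤ 1
    rw [upsum_eq _ (mem_Y.1 hν)]
    exact sum_rho_le _ _ _ _
  have h3 : ∑ μ ∈ Y (n+1), ∑ ν ∈ dn n μ, (H (rho r) μ - H (rho r) ν) * (1/(2*t) * d μ^2) ≤
      1/(2*t) * (n+1).factorial := by
    rw [← sum_d_sq, mul_sum]
    refine sum_le_sum fun ν hν => ?_
    rw [← sum_mul]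
    refine mul_le_of_le_one_left (by positivity) ?_
    change dnsum (rho r) n ν ≤ 1
    rw [dnsum_eq _ (mem_Y.1 hν)]
    exact sum_rho_le _ _ _ _
  rw [q, A, div_le_div_iff₀ (fpos _) ht0]
  have hf := fpos n
  rw [fsucc] at h3 ⊢
  rw [← ht2] at h3 ⊢
  have h4 : 1/(2*t) * (t*t*n.factorial) = t/2 * n.factorial := by field_simp
  nlinarith

theorem E_row (r n : ℕ) : E n (fun μ => (μ.rowLen r : ℝ)) = ∑ m ∈ range n, q r m := by
  have : (fun μ : YoungDiagram => (μ.rowLen r : ℝ)) = H (rho r) := funext fun μ => (H_rho r μ).symm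
  rw [this, E_eq_sum]; rfl

theorem sum_inv_sqrt (n : ℕ) : ∑ m ∈ range n, 1 / √((m:ℝ)+1) ≤ 2 * √(n:ℝ) := by
  induction n with
  | zero => simp
  | succ n ih =>
    rw [sum_range_succ]
    have h1 : 0 < √((n:ℝ)+1) := Real.sqrt_pos.2 (by positivity)
    have h2 := Real.mul_self_sqrt (by positivity : 0 ≤ (n:ℝ)+1)
    have h3 := Real.mul_self_sqrt (by positivity : 0 ≤ (n:ℝ))
    have h4 := Real.sqrt_nonneg (n:ℝ)
    push_cast
    have h5 : 1 / √((n:ℝ)+1) ≤ 2 * (√((n:ℝ)+1) - √(n:ℝ)) := by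
      rw [div_le_iff₀ h1]
      nlinarith [sq_nonneg (√((n:ℝ)+1) - √(n:ℝ))]
    linarith

theorem E_row_le (r n : ℕ) : E n (fun μ => (μ.rowLen r : ℝ)) ≤ 2 * √(n:ℝ) := by
  rw [E_row]
  exact (sum_le_sum fun m _ => q_le r m).trans (sum_inv_sqrt n)

noncomputable def s (K n : ℕ) : ℝ := ∑ r ∈ range (K+1), q r n

theorem s_nonneg (K n : ℕ) : 0 ≤ s K n := sum_nonneg fun r _ => q_nonneg r n

theorem s_le (K n : ℕ) : s K n ≤ (K+1) / √((n:ℝ)+1) := by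
  calc s K n ≤ ∑ r ∈ range (K+1), 1 / √((n:ℝ)+1) := sum_le_sum fun r _ => q_le r n
    _ = _ := by rw [sum_const, card_range, nsmul_eq_mul]; push_cast; ring

theorem s_eq (K n : ℕ) : s K n = A (fun x => if x.1 ≤ K then 1 else 0) n := by
  have : (fun x : ℕ × ℕ => if x.1 ≤ K then (1:ℝ) else 0) =
      fun x => ∑ r ∈ range (K+1), (1:ℝ) * rho r x := by
    funext x
    simp only [rho, one_mul]
    rw [sum_ite_eq]
    simp
  rw [this, A_sum]
  simp [s, q]

theorem s_mono_succ (K n : ℕ) : ((n:ℝ)+1) * s K n ≤ ((n+1:ℕ)+1) * s K (n+1) := by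
  have h := A_succ (fun x => if x.1 ≤ K then 1 else 0) n
  rw [← s_eq, ← s_eq] at h
  have h2 : 0 ≤ E (n+1) (fun ν => upsum (fun x => if x.1 ≤ K then 1 else 0) (n+1) ν
      - dnsum (fun x => if x.1 ≤ K then 1 else 0) n ν) := by
    exact (E_const (n+1) 0).symm.le.trans (E_mono fun ν hν => G_row K hν)
  push_cast
  have : (n:ℝ)+1+1 = n+2 := by ring
  rw [this, h]; linarith

theorem s_mono (K : ℕ) : Monotone fun n : ℕ => ((n:ℝ)+1) * s K n :=
  monotone_nat_of_le_succ (s_mono_succ K)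

noncomputable def L (K n : ℕ) : ℝ := ∑ m ∈ range n, s K m

theorem L_eq (K n : ℕ) : L K n = ∑ r ∈ range (K+1), E n (fun μ => (μ.rowLen r : ℝ)) := by
  simp_rw [E_row]
  rw [sum_comm]; rfl

theorem L_le (K n : ℕ) : L K n ≤ (K+1) * (2 * √(n:ℝ)) := by
  rw [L_eq]
  calc _ ≤ ∑ r ∈ range (K+1), 2 * √(n:ℝ) := sum_le_sum fun r _ => E_row_le r n
    _ = _ := by rw [sum_const, card_range, nsmul_eq_mul]; push_cast; ring

theorem L_ge (K n : ℕ) : (K+1) * E n (fun μ => (μ.rowLen K : ℝ)) ≤ L K n := by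
  rw [L_eq]
  calc _ = ∑ r ∈ range (K+1), E n (fun μ => (μ.rowLen K : ℝ)) := by
        rw [sum_const, card_range, nsmul_eq_mul]; push_cast; ring
    _ ≤ _ := by
        refine sum_le_sum fun r hr => E_mono fun ν _ => ?_
        have := ν.rowLen_anti r K (by rw [mem_range] at hr; omega)
        exact_mod_cast this

end PG

namespace PG
open Finset

theorem choose_half (k : ℕ) : ∀ᶠ n : ℕ in Filter.atTop,
    (n:ℝ)^k / k.factorial / 2 ≤ (n.choose k : ℝ) := by
  have h := (isEquivalent_choose k).isLittleO.bound (by norm_num : (0:ℝ) < 1/2)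
  filter_upwards [h] with n hn
  have h0 : (0:ℝ) ≤ (n:ℝ)^k / k.factorial := by positivity
  simp only [Pi.sub_apply, Real.norm_eq_abs, abs_of_nonneg h0] at hn
  have := (abs_le.1 hn).1
  linarith

noncomputable def cc (N : ℕ) (σ : ℝ) (i : ℕ) : ℝ := (σ⁻¹)^i * 2^(N-i) * N.choose i

theorem pow_expand (N : ℕ) (σ : ℝ) (x : ℕ × ℕ) :
    (ct x / σ + 2)^N = ∑ i ∈ range (N+1), cc N σ i * ct x ^ i := by
  rw [add_pow]
  refine sum_congr rfl fun i _ => ?_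
  rw [cc, div_eq_mul_inv, mul_pow]; ring

theorem cc_nonneg (N : ℕ) {σ : ℝ} (h : 0 ≤ σ) (i : ℕ) : 0 ≤ cc N σ i := by
  unfold cc; positivity

theorem mean_ge (N i n : ℕ) {σ : ℝ} (h : 0 ≤ σ) (hi : i ≤ N) :
    cc N σ i * M i n ≤ E n (H (fun x => (ct x / σ + 2)^N)) := by
  have e : E n (H (fun x => (ct x / σ + 2)^N)) = ∑ i ∈ range (N+1), cc N σ i * M i n := by
    have : H (fun x => (ct x / σ + 2)^N) =
        fun μ => ∑ i ∈ range (N+1), cc N σ i * H (fun x => ct x ^ i) μ := by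
      funext μ
      simp_rw [pow_expand]
      rw [H_sum (range (N+1)) (cc N σ) (fun i x => ct x ^ i)]
    rw [this, E_sum]; rfl
  rw [e]
  exact single_le_sum (f := fun i => cc N σ i * M i n)
    (fun i _ => mul_nonneg (cc_nonneg N h i) (M_nonneg _ _)) (by simp; omega)

theorem sq_bound (N : ℕ) : ∃ C : ℝ, 0 ≤ C ∧ ∀ n : ℕ,
    A (fun x => ((ct x / √((n:ℝ)+1) + 2)^N)^2) n ≤ C := by
  choose C hC0 hC using a_upper
  refine ⟨∑ i ∈ range (N*2+1), 2^(N*2-i) * (N*2).choose i * C i,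
    sum_nonneg fun i _ => mul_nonneg (by positivity) (hC0 i), fun n => ?_⟩
  simp_rw [← pow_mul, pow_expand]
  rw [A_sum]
  refine sum_le_sum fun i _ => ?_
  change _ * a i n ≤ _
  rcases Nat.even_or_odd i with he | ho
  · have h1 := hC i n
    obtain ⟨l, hl⟩ := he
    have hl2 : i/2 = l := by omega
    rw [hl2] at h1
    have hs : (√((n:ℝ)+1))^i = ((n:ℝ)+1)^l := by
      rw [hl, ← two_mul, pow_mul, Real.sq_sqrt (by positivity)]
    unfold cc
    rw [inv_pow, hs]
    have hp : 0 < ((n:ℝ)+1)^l := by positivity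
    calc _ = (2^(N*2-i) * (N*2).choose i) * ((((n:ℝ)+1)^l)⁻¹ * a i n) := by ring
      _ ≤ (2^(N*2-i) * (N*2).choose i) * C i := by
        refine mul_le_mul_of_nonneg_left ?_ (by positivity)
        rw [inv_mul_le_iff₀ hp]; linarith
  · rw [a_odd i ho, mul_zero]
    exact mul_nonneg (by positivity) (hC0 i)

theorem det_bound (N K n : ℕ) (hN : Odd N) {σ ε R : ℝ} (hσ : 0 < σ) (hε : ε ≤ 2) (hR : 0 ≤ R)
    {ν : YoungDiagram} (hν : ν.card = n) (h1 : (ν.rowLen K : ℝ) ≤ (2-ε)*σ)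
    (h2 : (ν.rowLen 0 : ℝ) ≤ R * σ) :
    H (fun x => (ct x / σ + 2)^N) ν ≤ n * (4-ε)^N + K * (R*σ) * (R+2)^N := by
  have hb : 0 ≤ 4 - ε := by linarith
  have key : ∀ x ∈ ν.cells, (ct x / σ + 2)^N ≤
      (4-ε)^N + ∑ r ∈ range K, (R+2)^N * rho r x := by
    rintro ⟨i, j⟩ hx
    rw [YoungDiagram.mem_cells, YoungDiagram.mem_iff_lt_rowLen] at hx
    have hct : ct (i,j) ≤ j := by simp [ct]
    by_cases hi : i < K
    · have e : ∑ r ∈ range K, (R+2)^N * rho r (i,j) = (R+2)^N := by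
        simp only [rho]
        simp [hi]
      rw [e]
      have h3 : ct (i,j) / σ + 2 ≤ R + 2 := by
        have := ν.rowLen_anti 0 i (by omega)
        have h4 : (j:ℝ) ≤ ν.rowLen 0 := by exact_mod_cast (by omega)
        have : ct (i,j)/σ ≤ R := by rw [div_le_iff₀ hσ]; linarith
        linarith
      have := hN.pow_le_pow.2 h3
      have : 0 ≤ (4-ε)^N := by positivity
      linarith
    · have h3 : ct (i,j) / σ + 2 ≤ 4 - ε := by
        have := ν.rowLen_anti K i (by omega)
        have h4 : (j:ℝ) ≤ ν.rowLen K := by exact_mod_cast (by omega)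
        have : ct (i,j)/σ ≤ 2 - ε := by rw [div_le_iff₀ hσ]; linarith
        linarith
      have := hN.pow_le_pow.2 h3
      have : 0 ≤ ∑ r ∈ range K, (R+2)^N * rho r (i,j) :=
        sum_nonneg fun r _ => mul_nonneg (by positivity) (rho_nonneg _ _)
      linarith
  calc H (fun x => (ct x / σ + 2)^N) ν ≤
      ∑ x ∈ ν.cells, ((4-ε)^N + ∑ r ∈ range K, (R+2)^N * rho r x) := sum_le_sum key
    _ = n * (4-ε)^N + ∑ r ∈ range K, (R+2)^N * (ν.rowLen r : ℝ) := by
      rw [sum_add_distrib]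
      congr 1
      · rw [sum_const, nsmul_eq_mul, ← hν]
      · change H (fun x => ∑ r ∈ range K, (R+2)^N * rho r x) ν = _
        rw [H_sum (range K) (fun _ => (R+2)^N) rho]
        simp_rw [H_rho]
    _ ≤ n * (4-ε)^N + ∑ r ∈ range K, (R+2)^N * (R*σ) := by
      gcongr with r hr
      refine le_trans ?_ h2
      exact_mod_cast ν.rowLen_anti 0 r (by omega)
    _ = _ := by rw [sum_const, card_range, nsmul_eq_mul]; ring

theorem exists_j {b : ℝ} (hb : 0 < b) (hb4 : b < 4) : ∃ j : ℕ,
    2 * b^(4*j+1) ≤ (4*j+1).choose (2*j) * 2^(2*j+1) * cat j / (j+1) / 2 := by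
  have hx0 : 0 < b/4 := by positivity
  have hx1 : b/4 < 1 := by linarith
  have h := tendsto_pow_const_mul_const_pow_of_abs_lt_one 4 (r := b/4)
    (by rw [abs_of_pos hx0]; exact hx1)
  have h2 := h.eventually (gt_mem_nhds (by norm_num : (0:ℝ) < 1/64))
  obtain ⟨m, hm, hm2⟩ := (h2.and (Filter.eventually_ge_atTop 2)).exists
  obtain ⟨j, rfl⟩ : ∃ j, m = j+1 := ⟨m-1, by omega⟩
  have hj : 1 ≤ j := by omega
  refine ⟨j, ?_⟩
  have c1 : (4:ℝ)^j ≤ 2 * j * j.centralBinom := by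
    exact_mod_cast Nat.four_pow_le_two_mul_self_mul_centralBinom j (by omega)
  have c2 : (4:ℝ)^(2*j+1) ≤ 2 * (2*j+1) * (2*j+1).centralBinom := by
    exact_mod_cast Nat.four_pow_le_two_mul_self_mul_centralBinom (2*j+1) (by omega)
  have c3 : ((2*j+1).centralBinom : ℝ) = 2 * (4*j+1).choose (2*j) := by
    have : (2*j+1).centralBinom = 2 * (4*j+1).choose (2*j) := by
      rw [Nat.centralBinom_eq_two_mul_choose, show 2*(2*j+1) = (4*j+1)+1 by ring,
        Nat.choose_succ_succ, ← Nat.choose_symm (n := 4*j+1) (k := 2*j+1) (by omega),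
        show 4*j+1-(2*j+1) = 2*j by omega]
      ring
    exact_mod_cast this
  have hjp : (0:ℝ) < j := by exact_mod_cast hj
  have hpow : b^(4*j+1) ≤ 4^(4*j+1) * (b/4)^(j+1) := by
    calc b^(4*j+1) = 4^(4*j+1) * (b/4)^(4*j+1) := by rw [← mul_pow]; congr 1; ring
      _ ≤ _ := mul_le_mul_of_nonneg_left
        (pow_le_pow_of_le_one hx0.le hx1.le (by omega)) (by positivity)
  push_cast at hm
  have hb2 : b^(4*j+1) * (64 * ((j:ℝ)+1)^4) ≤ 4^(4*j+1) := by
    calc _ ≤ 4^(4*j+1) * (b/4)^(j+1) * (64 * ((j:ℝ)+1)^4) :=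
          mul_le_mul_of_nonneg_right hpow (by positivity)
      _ = 4^(4*j+1) * (64 * (((j:ℝ)+1)^4 * (b/4)^(j+1))) := by ring
      _ ≤ 4^(4*j+1) * 1 := by
          refine mul_le_mul_of_nonneg_left ?_ (by positivity)
          linarith
      _ = _ := mul_one _
  rw [c3] at c2
  have e4 : (4:ℝ)^(4*j+1) * 2 = 4^(2*j+1) * 2^(2*j+1) * 4^j := by
    rw [show (4:ℝ) = 2^2 by norm_num]
    simp only [← pow_mul, ← pow_succ, ← pow_add]
    congr 1; ring
  have e5 : (4:ℝ)^(4*j+1) * 2 ≤ (2*(2*j+1)*(2*(4*j+1).choose (2*j))) * 2^(2*j+1) *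
      (2*j*j.centralBinom) := by
    rw [e4]
    gcongr
  set Q : ℝ := (4*j+1).choose (2*j) * 2^(2*j+1) * j.centralBinom with hQ
  have hQ0 : 0 ≤ Q := by positivity
  have e6 : (4*j+1).choose (2*j) * 2^(2*j+1) * cat j / (j+1) / 2 = Q / (2*((j:ℝ)+1)^2) := by
    rw [cat, hQ]; field_simp
  rw [e6, le_div_iff₀ (by positivity)]
  have e7 : (2*(2*j+1)*(2*(4*j+1).choose (2*j))) * 2^(2*j+1) *
      (2*j*j.centralBinom) = 8*j*(2*j+1) * Q := by rw [hQ]; ring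
  rw [e7] at e5
  have e8 : 8*(j:ℝ)*(2*j+1) ≤ 16 * (j+1)^2 := by nlinarith
  have e9 : (4:ℝ)^(4*j+1) * 2 ≤ 16*(j+1)^2 * Q := e5.trans (mul_le_mul_of_nonneg_right e8 hQ0)
  have e10 : (b^(4*j+1) * (8*((j:ℝ)+1)^2)) * (j+1)^2 ≤ Q * (j+1)^2 := by
    nlinarith
  have e11 := le_of_mul_le_mul_right e10 (by positivity)
  have : 0 ≤ b^(4*j+1) * ((j:ℝ)+1)^2 := by positivity
  linarith

end PG

namespace PG
open Finset

set_option maxHeartbeats 1000000 in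
theorem row_lower (K : ℕ) {ε : ℝ} (hε0 : 0 < ε) (hε1 : ε ≤ 1) : ∀ᶠ n : ℕ in Filter.atTop,
    (2-ε) * √((n:ℝ)+1) ≤ E (n+1) (fun μ => (μ.rowLen K : ℝ)) := by
  set b := 4 - ε/2 with hb
  have hb0 : 0 < b := by linarith
  obtain ⟨j, hj⟩ := exists_j hb0 (by linarith : b < 4)
  set N := 4*j+1 with hN
  have hNodd : Odd N := ⟨2*j, by omega⟩
  obtain ⟨C, hC0, hC⟩ := sq_bound N
  set R := 12/ε with hR
  have hR0 : 0 < R := by positivity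
  have hbN : 0 < b^N := by positivity
  have ev1 : ∀ᶠ n : ℕ in Filter.atTop, ((n+1:ℕ):ℝ)^(j+1) / (j+1).factorial / 2 ≤
      ((n+1).choose (j+1) : ℝ) := (Filter.tendsto_add_atTop_nat 1).eventually (choose_half (j+1))
  have tn : Filter.Tendsto (fun n : ℕ => (n:ℝ)+1) Filter.atTop Filter.atTop :=
    Filter.tendsto_atTop_add_const_right _ _ tendsto_natCast_atTop_atTop
  have ev2 := (Real.tendsto_sqrt_atTop.comp tn).eventually_ge_atTop (2 * (K*R*(R+2)^N)/b^N)
  have ev3 := tn.eventually_ge_atTop (4*C*R/(b^N)^2)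
  filter_upwards [ev1, ev2, ev3] with n h1 h2 h3
  simp only [Function.comp_apply] at h2
  set σ := √((n:ℝ)+1) with hσ
  have hσ0 : 0 < σ := Real.sqrt_pos.2 (by positivity)
  have hσ2 : σ^2 = n+1 := Real.sq_sqrt (by positivity)
  have hn0 : (0:ℝ) < n+1 := by positivity
  set φ : ℕ × ℕ → ℝ := fun x => (ct x / σ + 2)^N with hφ
  set m := E (n+1) (H φ) with hm
  have hmean : (n+1) * (2*b^N) ≤ m := by
    have g1 := mean_ge N (2*j) (n+1) hσ0.le (by omega)
    have g2 := M_lower j (n+1)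
    refine le_trans ?_ g1
    have g3 : cat j * j.factorial * (((n+1:ℕ):ℝ)^(j+1) / (j+1).factorial / 2) ≤ M (2*j) (n+1) :=
      (mul_le_mul_of_nonneg_left h1 (mul_nonneg (cat_nonneg j) (by positivity))).trans g2
    refine le_trans ?_ (mul_le_mul_of_nonneg_left g3 (cc_nonneg N hσ0.le _))
    refine (mul_le_mul_of_nonneg_left hj hn0.le).trans (le_of_eq ?_)
    rw [cc, inv_pow, pow_mul, hσ2, fsucc, show N - 2*j = 2*j+1 by omega]
    have := fpos j
    push_cast
    field_simp
    ring
  set D := (n+1) * b^N / 2 with hD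
  have hD0 : 0 < D := by positivity
  have hrow : K * (R*σ) * (R+2)^N ≤ D := by
    rw [div_le_iff₀ hbN] at h2
    have := mul_le_mul_of_nonneg_right h2 hσ0.le
    rw [hD, ← hσ2]
    nlinarith
  have hvar := variance φ n
  have hvar2 : E (n+1) (fun μ => (H φ μ - m)^2) ≤ (n+1)*C :=
    hvar.trans (mul_le_mul_of_nonneg_left (hC n) hn0.le)
  have hpt : ∀ ν : YoungDiagram, ν.card = n+1 → ((2-ε/2)*σ + (-((2-ε/2)*σ/D^2)) * (H φ ν - m)^2) +
      (-((2-ε/2)/R)) * (ν.rowLen 0 : ℝ) ≤ ν.rowLen K := by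
    intro ν hν
    have p0 : 0 < 2 - ε/2 := by linarith
    have p1 : 0 ≤ (2-ε/2)*σ/D^2 * (H φ ν - m)^2 := by positivity
    have p2 : 0 ≤ (2-ε/2)/R * (ν.rowLen 0 : ℝ) := by positivity
    have p3 : (0:ℝ) ≤ ν.rowLen K := by positivity
    by_cases c1 : (ν.rowLen K : ℝ) ≤ (2-ε/2)*σ
    · by_cases c2 : (ν.rowLen 0 : ℝ) ≤ R*σ
      · have k1 := det_bound N K (n+1) hNodd hσ0 (by linarith) hR0.le hν c1 c2
        change H φ ν ≤ _ at k1
        rw [← hb] at k1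
        push_cast at k1
        have k2 : D ≤ m - H φ ν := by
          have : ((n:ℝ)+1)*b^N = 2 * D := by rw [hD]; ring
          linarith
        have k3 : D^2 ≤ (H φ ν - m)^2 := by nlinarith
        have k4 : (2-ε/2)*σ ≤ (2-ε/2)*σ/D^2 * (H φ ν - m)^2 := by
          rw [div_mul_eq_mul_div, le_div_iff₀ (by positivity)]
          exact mul_le_mul_of_nonneg_left k3 (by positivity)
        linarith
      · push Not at c2
        have k4 : (2-ε/2)*σ ≤ (2-ε/2)/R * (ν.rowLen 0 : ℝ) := by
          rw [div_mul_eq_mul_div, le_div_iff₀ hR0, mul_assoc]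
          exact mul_le_mul_of_nonneg_left (by linarith) p0.le
        linarith
    · push Not at c1
      linarith
  have hE := E_mono hpt
  have eA := E_mul (n+1) (-((2-ε/2)*σ/D^2)) (fun ν => (H φ ν - m)^2)
  have eB := E_mul (n+1) (-((2-ε/2)/R)) (fun ν => (ν.rowLen 0 : ℝ))
  rw [E_add, E_add, eA, eB, E_const] at hE
  have hE0 := E_row_le 0 (n+1)
  push_cast at hE0
  rw [← hσ] at hE0
  refine le_trans ?_ hE
  have p0 : 0 < 2 - ε/2 := by linarith
  have k1 : (2-ε/2)*σ/D^2 * E (n+1) (fun μ => (H φ μ - m)^2) ≤ (2-ε/2)*σ/R := by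
    calc _ ≤ (2-ε/2)*σ/D^2 * ((n+1)*C) := mul_le_mul_of_nonneg_left hvar2 (by positivity)
      _ ≤ _ := by
        rw [div_mul_eq_mul_div, div_le_div_iff₀ (by positivity) hR0, mul_assoc]
        refine mul_le_mul_of_nonneg_left ?_ (by positivity)
        rw [div_le_iff₀ (by positivity)] at h3
        have := mul_le_mul_of_nonneg_left h3 hn0.le
        rw [hD]
        nlinarith
  have k2 : (2-ε/2)/R * E (n+1) (fun μ => (μ.rowLen 0 : ℝ)) ≤ (2-ε/2)/R * (2*σ) :=
    mul_le_mul_of_nonneg_left hE0 (by positivity)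
  have k3 : (2-ε/2)*σ/R = (2-ε/2)*σ*ε/12 := by rw [hR]; field_simp
  have k4 : (2-ε/2)/R*(2*σ) = (2-ε/2)*σ*ε/6 := by rw [hR]; field_simp; ring
  rw [k3] at k1
  rw [k4] at k2
  have : 0 < σ*ε := by positivity
  nlinarith

end PG

namespace PG
open Finset

theorem s_lim (K : ℕ) : Filter.Tendsto (fun n : ℕ => √((n:ℝ)+1) * s K n) Filter.atTop
    (nhds ((K:ℝ)+1)) := by
  have hK : (0:ℝ) < K + 1 := by positivity
  have upper : ∀ n : ℕ, √((n:ℝ)+1) * s K n ≤ K + 1 := by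
    intro n
    have hσ0 : 0 < √((n:ℝ)+1) := Real.sqrt_pos.2 (by positivity)
    have := s_le K n
    rw [le_div_iff₀ hσ0] at this
    linarith
  rw [tendsto_order]
  refine ⟨fun c hc => ?_, fun c hc => Filter.Eventually.of_forall fun n => (upper n).trans_lt hc⟩
  obtain ⟨t, ht, ht1⟩ := exists_between (show max 0 (c/(K+1)) < 1 from
    max_lt one_pos ((div_lt_one hK).2 hc))
  have ht0 : 0 < t := (le_max_left _ _).trans_lt ht
  have htc : c < t * (K+1) := (div_lt_iff₀ hK).1 ((le_max_right _ _).trans_lt ht)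
  set θ := √t with hθ
  have hθ0 : 0 < θ := Real.sqrt_pos.2 ht0
  have hθ2 : θ^2 = t := Real.sq_sqrt ht0.le
  have hθ1 : θ < 1 := by nlinarith
  have ev := row_lower K (ε := (1-θ)^2) (by have : 0 < 1 - θ := by linarith
                                            positivity) (by nlinarith)
  have tn : Filter.Tendsto (fun n : ℕ => (n:ℝ)+1) Filter.atTop Filter.atTop :=
    Filter.tendsto_atTop_add_const_right _ _ tendsto_natCast_atTop_atTop
  have ev2 := tn.eventually_gt_atTop ((K+1)/((1-t)*(t*(K+1)-c)))
  filter_upwards [ev, ev2] with n h1 h2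
  have hu := upper n
  set σ := √((n:ℝ)+1) with hσ
  have hσ0 : 0 < σ := Real.sqrt_pos.2 (by positivity)
  have hσ2 : σ^2 = n+1 := Real.sq_sqrt (by positivity)
  have hn0 : (0:ℝ) < n+1 := by positivity
  set n' := ⌊t * (n+1)⌋₊ with hn'
  have f1 : (n':ℝ) ≤ t*(n+1) := Nat.floor_le (by positivity)
  have f2 : t*(n+1) < n' + 1 := Nat.lt_floor_add_one _
  have f3 : n' ≤ n+1 := by
    have : (n':ℝ) ≤ (n+1:ℕ) := by push_cast; nlinarith
    exact_mod_cast this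
  have g0 : 0 ≤ ((n:ℝ)+1) * s K n := mul_nonneg hn0.le (s_nonneg _ _)
  have l1 : L K (n+1) - L K n' ≤ (((n:ℝ)+1) * s K n) / (t*(n+1)) * ((n+1) - n') := by
    rw [L, L, ← sum_Ico_eq_sub _ f3]
    calc _ ≤ ∑ m ∈ Ico n' (n+1), (((n:ℝ)+1) * s K n) / (t*(n+1)) := by
          refine sum_le_sum fun m hm => ?_
          rw [mem_Ico] at hm
          have hmono := s_mono K (show m ≤ n by omega)
          simp only at hmono
          rw [le_div_iff₀ (by positivity)]
          have hm' : (n':ℝ) ≤ m := by exact_mod_cast hm.1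
          have : s K m * (t*(n+1)) ≤ s K m * (m+1) :=
            mul_le_mul_of_nonneg_left (by linarith) (s_nonneg _ _)
          linarith
      _ = _ := by
          rw [sum_const, Nat.card_Ico, nsmul_eq_mul, Nat.cast_sub f3]; push_cast; ring
  have e1 : (((n:ℝ)+1) * s K n) / (t*(n+1)) = s K n / t := by field_simp
  rw [e1] at l1
  have l2 : L K n' ≤ (K+1) * (2*(θ*σ)) := by
    refine (L_le K n').trans ?_
    have : √(n':ℝ) ≤ θ*σ := by
      rw [hθ, hσ, ← Real.sqrt_mul ht0.le]
      exact Real.sqrt_le_sqrt f1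
    gcongr
  have l3 := L_ge K (n+1)
  have l4 := mul_le_mul_of_nonneg_left h1 hK.le
  have s0 := s_nonneg K n
  have l5 : s K n / t * ((n+1) - n') ≤ s K n / t * ((1-t)*(n+1) + 1) :=
    mul_le_mul_of_nonneg_left (by linarith) (by positivity)
  have l6 : (K+1) * ((1-t) * σ) ≤ s K n / t * ((1-t)*(n+1) + 1) := by
    have : (1-t) * σ = (2 - (1-θ)^2)*σ - 2*(θ*σ) := by rw [← hθ2]; ring
    rw [this]
    linarith
  have l7 : (K+1) * ((1-t) * σ) * t ≤ s K n * ((1-t)*(n+1) + 1) := by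
    rw [div_mul_eq_mul_div, le_div_iff₀ ht0] at l6
    exact l6
  set y := σ * s K n with hy
  have l8 : (K+1) * (1-t) * t * (n+1) ≤ y * (1-t) * (n+1) + (K+1) := by
    have a1 := mul_le_mul_of_nonneg_left l7 hσ0.le
    have a2 : σ * ((K+1) * ((1-t) * σ) * t) = (K+1) * (1-t) * t * (n+1) := by
      rw [← hσ2]; ring
    have a3 : σ * (s K n * ((1-t)*(n+1) + 1)) = y * (1-t) * (n+1) + y := by rw [hy]; ring
    linarith
  have p1 : 0 < 1 - t := by linarith
  have p2 : 0 < t*(K+1) - c := by linarith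
  rw [div_lt_iff₀ (by positivity)] at h2
  by_contra hcon
  push Not at hcon
  have : y * ((1-t)*(n+1)) ≤ c * ((1-t)*(n+1)) := mul_le_mul_of_nonneg_right hcon (by positivity)
  nlinarith

end PG

namespace PG
open Finset MeasureTheory

theorem meas_tail {Ω : Type*} [MeasurableSpace Ω] {lam : ℕ → Ω → YoungDiagram}
    (hm : ∀ (n : ℕ) (y : YoungDiagram), MeasurableSet {ω | lam n ω = y}) (k n : ℕ)
    (path : ℕ → YoungDiagram) :
    MeasurableSet {ω | ∀ i, k ≤ i → i ≤ n → lam i ω = path i} := by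
  simp only [Set.setOf_forall]
  exact MeasurableSet.iInter fun i => MeasurableSet.iInter fun _ => MeasurableSet.iInter fun _ =>
    hm i _

theorem tail_ge {Ω : Type*} [MeasurableSpace Ω] {P : Measure Ω}
    {lam : ℕ → Ω → YoungDiagram} (h : IsPlancherelGrowthProcess P lam) (n : ℕ) (k : ℕ) :
    ∀ (path : ℕ → YoungDiagram), k ≤ n → (path k).card = k →
    (∀ i, k ≤ i → i < n → path i ≤ path (i + 1) ∧ (path (i + 1)).card = (path i).card + 1) →
    d (path k) * d (path n) / n.factorial ≤
      P.real {ω | ∀ i, k ≤ i → i ≤ n → lam i ω = path i} := by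
  obtain ⟨hprob, hm, hp⟩ := h
  induction k with
  | zero =>
    intro path _ hc hs
    have h0 : path 0 = ⊥ := eq_bot_of_card hc
    have h1 := hp n path h0 (fun i hi => hs i (Nat.zero_le _) hi)
    have e : {ω | ∀ i, 0 ≤ i → i ≤ n → lam i ω = path i} = {ω | ∀ i ≤ n, lam i ω = path i} := by
      ext ω; simp
    rw [e, measureReal_def, h1, h0, d_bot, one_mul, ENNReal.toReal_div]
    simp [d]
  | succ k ih =>
    intro path hk hc hs
    classical
    set S : YoungDiagram → Set Ω := fun ν =>
      {ω | ∀ i, k ≤ i → i ≤ n → lam i ω = Function.update path k ν i} with hS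
    have hdis : (dn k (path (k+1)) : Set YoungDiagram).PairwiseDisjoint S := by
      intro ν _ ν' _ hne
      rw [Function.onFun, Set.disjoint_left]
      intro ω h1 h2
      have a1 := h1 k le_rfl (by omega)
      have a2 := h2 k le_rfl (by omega)
      simp only [Function.update_self] at a1 a2
      exact hne (a1.symm.trans a2)
    have hsub : (⋃ ν ∈ dn k (path (k+1)), S ν) ⊆
        {ω | ∀ i, k+1 ≤ i → i ≤ n → lam i ω = path i} := by
      intro ω hω
      simp only [Set.mem_iUnion] at hω
      obtain ⟨ν, _, hω⟩ := hω
      intro i hi hin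
      have := hω i (by omega) hin
      rwa [Function.update_of_ne (by omega)] at this
    have hsum := measureReal_biUnion_finset (μ := P) hdis (fun ν _ => meas_tail hm k n _)
    refine le_trans ?_ (measureReal_mono hsub)
    rw [hsum, d_rec hc, sum_mul, sum_div]
    refine sum_le_sum fun ν hν => ?_
    rw [mem_dn] at hν
    have := ih (Function.update path k ν) (by omega) (by simp [hν.1]) (by
      intro i hi hin
      rcases Nat.eq_or_lt_of_le hi with rfl | hlt
      · rw [Function.update_self, Function.update_of_ne (by omega)]
        exact ⟨hν.2, by rw [hc, hν.1]⟩
      · rw [Function.update_of_ne (by omega), Function.update_of_ne (by omega)]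
        exact hs i (by omega) hin)
    rw [Function.update_self, Function.update_of_ne (by omega)] at this
    exact this

noncomputable def edges (n : ℕ) : Finset (Σ _ : YoungDiagram, YoungDiagram) :=
  (Y n).sigma fun ν => up n ν

noncomputable def wt (n : ℕ) (e : Σ _ : YoungDiagram, YoungDiagram) : ℝ :=
  d e.1 * d e.2 / (n+1).factorial

theorem sum_wt (n : ℕ) : ∑ e ∈ edges n, wt n e = 1 := by
  rw [edges, sum_sigma]
  simp only [wt]
  have : ∀ ν ∈ Y n, ∑ μ ∈ up n ν, d ν * d μ / (n+1).factorial = d ν ^ 2 / n.factorial := by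
    intro ν hν
    rw [← sum_div, ← mul_sum, sum_up_d n (mem_Y.1 hν), fsucc]
    have := fpos n
    field_simp
  rw [sum_congr rfl this, ← sum_div, sum_d_sq]
  exact div_self (fpos n).ne'

theorem sub_ge {Ω : Type*} [MeasurableSpace Ω] {P : Measure Ω}
    {lam : ℕ → Ω → YoungDiagram} (h : IsPlancherelGrowthProcess P lam) (n : ℕ)
    (F : Finset (Σ _ : YoungDiagram, YoungDiagram)) (hF : F ⊆ edges n) :
    ∑ e ∈ F, wt n e ≤ P.real (⋃ e ∈ F, {ω | lam n ω = e.1 ∧ lam (n+1) ω = e.2}) := by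
  have hprob := h.1
  have hm := h.2.1
  rw [measureReal_biUnion_finset]
  · refine sum_le_sum fun e he => ?_
    have hE := hF he
    simp only [edges, mem_sigma, mem_Y, mem_up] at hE
    have := tail_ge h (n+1) n (fun i => if i ≤ n then e.1 else e.2) (by omega) (by simp [hE.1]) (by
      intro i hi hin
      have : i = n := by omega
      subst this
      simp only [le_refl, if_true, Nat.not_succ_le_self, if_false, hE]
      trivial)
    simp only [le_refl, if_true, Nat.not_succ_le_self, if_false] at this
    refine this.trans (measureReal_mono ?_)
    intro ω hω
    have a1 := hω n le_rfl (by omega)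
    have a2 := hω (n+1) (by omega) le_rfl
    simp only [le_refl, if_true, Nat.not_succ_le_self, if_false] at a1 a2
    exact ⟨a1, a2⟩
  · rintro ⟨a, b⟩ _ ⟨a', b'⟩ _ hne
    rw [Function.onFun, Set.disjoint_left]
    rintro ω ⟨h1, h2⟩ ⟨h3, h4⟩
    simp only at h1 h2 h3 h4
    exact hne (by rw [← h1, ← h2, ← h3, ← h4])
  · exact fun e _ => (hm n e.1).inter (hm (n+1) e.2)

theorem prob_eq {Ω : Type*} [MeasurableSpace Ω] {P : Measure Ω}
    {lam : ℕ → Ω → YoungDiagram} (h : IsPlancherelGrowthProcess P lam) (n r : ℕ) :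
    (P (growthEvent lam n r)).toReal = q r n := by
  classical
  have hprob := h.1
  have hm := h.2.1
  set c : (Σ _ : YoungDiagram, YoungDiagram) → Prop := fun e => e.2.rowLen r = e.1.rowLen r + 1
    with hc
  have hq : q r n = ∑ e ∈ (edges n).filter c, wt n e := by
    rw [sum_filter, edges, sum_sigma, q, A, T, sum_div]
    refine sum_congr rfl fun ν hν => ?_
    rw [sum_div]
    refine sum_congr rfl fun μ hμ => ?_
    have hμ' := hμ
    rw [mem_up] at hμ'
    rw [mem_Y] at hν
    obtain ⟨x, hx, hcx⟩ := exists_insert hμ'.2 (by omega)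
    have e1 := H_edge hx hcx (rho r)
    rw [H_rho, H_rho] at e1 ⊢
    simp only [hc, wt]
    rw [e1]
    split_ifs with hcc
    · rw [hcc] at e1
      push_cast at e1
      rw [← e1]; ring
    · have : rho r x = 0 := by
        by_contra hne
        have h1 : rho r x = 1 := by
          unfold rho at hne ⊢
          split_ifs at hne ⊢ with hh
          · rfl
          · exact absurd rfl hne
        rw [h1] at e1
        apply hcc
        have : (μ.rowLen r : ℝ) = ν.rowLen r + 1 := by linarith
        exact_mod_cast this
      rw [this]; ring
  have hadd := sum_filter_add_sum_filter_not (edges n) c (wt n)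
  rw [sum_wt, ← hq] at hadd
  change P.real _ = _
  apply le_antisymm
  · have h1 := sub_ge h n ((edges n).filter fun e => ¬ c e) (filter_subset _ _)
    set U := ⋃ e ∈ (edges n).filter fun e => ¬ c e, {ω | lam n ω = e.1 ∧ lam (n+1) ω = e.2} with hU
    have hUm : MeasurableSet U := Finset.measurableSet_biUnion _
      fun e _ => (hm n e.1).inter (hm (n+1) e.2)
    have h2 := prob_compl_eq_one_sub (μ := P) hUm
    have h3 : P.real Uᶜ = 1 - P.real U := probReal_compl_eq_one_sub hUm
    have h4 : growthEvent lam n r ⊆ Uᶜ := by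
      intro ω hω hU'
      simp only [hU, Set.mem_iUnion, mem_filter] at hU'
      obtain ⟨e, ⟨_, he⟩, a1, a2⟩ := hU'
      apply he
      simp only [hc]
      rw [← a1, ← a2]; exact hω
    have h5 : P.real (growthEvent lam n r) ≤ P.real Uᶜ := measureReal_mono h4
    linarith
  · rw [hq]
    refine (sub_ge h n _ (filter_subset _ _)).trans (measureReal_mono ?_)
    intro ω hω
    simp only [Set.mem_iUnion, mem_filter] at hω
    obtain ⟨e, ⟨_, he⟩, a1, a2⟩ := hω
    change (lam (n+1) ω).rowLen r = (lam n ω).rowLen r + 1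
    rw [a1, a2]; exact he

end PG

/-- Fix `K ≥ 0` and let `s_n = ∑_{0 ≤ r ≤ K} ℙ(E_r⁽ⁿ⁾)` for `n ≥ 1`.  Then
`lim_{n→∞} √n · s_n = K + 1`.  (With our indexing,
`s_{n+1} = ∑_{r ≤ K} ℙ(growthEvent lam n r)`.) -/
theorem sqrt_mul_sum_growth_prob_tendsto {Ω : Type*} [MeasurableSpace Ω] (P : Measure Ω)
    (lam : ℕ → Ω → YoungDiagram) (hPGP : IsPlancherelGrowthProcess P lam) (K : ℕ) :
    Filter.Tendsto
      (fun n : ℕ => Real.sqrt (n + 1) *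
        ∑ r ∈ Finset.range (K + 1), (P (growthEvent lam n r)).toReal)
      Filter.atTop (nhds (K + 1 : ℝ)) := by
  simp_rw [PG.prob_eq hPGP]
  exact PG.s_lim K
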